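/- arXiv:2112.13720 — 8 statements merged into one kernel-verified Lean document; each statement's English description precedes it below -/
import Mathlib

section
/- For every non-integer real α > 0 and every natural number n, ∫₀^π ((1 + cos θ)/2)^α · cos(nθ) dθ = √π · Γ(α + 1/2) · Γ(α + 1) / (Γ(α − n + 1) · Γ(α + n + 1)). -/
open MeasureTheory Set in
/-- The real Beta integral in terms of the Gamma function. -/
lemma integral_rpow_mul_one_sub_rpow {a b : ℝ} (ha : 0 < a) (hb : 0 < b) :
    ∫ x in Ioo (0 : ℝ) 1, x ^ (a - 1) * (1 - x) ^ (b - 1) =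
      Real.Gamma a * Real.Gamma b / Real.Gamma (a + b) := by
  change _ = ProbabilityTheory.beta a b
  rw [ProbabilityTheory.beta_eq_betaIntegralReal a b ha hb,
    Complex.betaIntegral, intervalIntegral.integral_of_le (by norm_num),
    ← integral_Ioc_eq_integral_Ioo, ← RCLike.re_to_complex, ← integral_re]
  · refine setIntegral_congr_fun measurableSet_Ioc fun x ⟨hx₁, hx₂⟩ ↦ ?_
    norm_cast
    rw [← Complex.ofReal_cpow, ← Complex.ofReal_cpow, RCLike.re_to_complex,
      Complex.re_mul_ofReal, Complex.ofReal_re]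
    all_goals linarith
  · convert! Complex.betaIntegral_convergent (u := a) (v := b) (by simpa) (by simpa)
    rw [intervalIntegrable_iff_integrableOn_Ioc_of_le (by simp), IntegrableOn]

open Set in
lemma image_one_add_cos_div_two_Ioo :
    (fun θ : ℝ ↦ (1 + Real.cos θ) / 2) '' Ioo 0 Real.pi = Ioo 0 1 := by
  ext x
  constructor
  · rintro ⟨θ, ⟨h0, hpi⟩, rfl⟩
    have hs := Real.sin_pos_of_pos_of_lt_pi h0 hpi
    have := Real.sin_sq_add_cos_sq θ
    constructor <;> dsimp only <;> nlinarith
  · rintro ⟨h0, h1⟩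
    refine ⟨Real.arccos (2 * x - 1), ⟨Real.arccos_pos.2 (by linarith), ?_⟩, ?_⟩
    · refine lt_of_le_of_ne (Real.arccos_le_pi _) fun h ↦ ?_
      rw [Real.arccos_eq_pi] at h
      linarith
    · dsimp only
      rw [Real.cos_arccos (by linarith) (by linarith)]
      ring

open MeasureTheory Set in
lemma integral_one_add_cos_div_two_rpow {α : ℝ} (hα : -(1 / 2) < α) :
    ∫ θ in (0 : ℝ)..Real.pi, ((1 + Real.cos θ) / 2) ^ α =
      Real.sqrt Real.pi * Real.Gamma (α + 1 / 2) / Real.Gamma (α + 1) := by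
  have hB := integral_rpow_mul_one_sub_rpow (a := α + 1 / 2) (b := 1 / 2)
    (by linarith) (by norm_num)
  have hinj : InjOn (fun θ : ℝ ↦ (1 + Real.cos θ) / 2) (Ioo 0 Real.pi) := fun x hx y hy h ↦
    Real.injOn_cos (Ioo_subset_Icc_self hx) (Ioo_subset_Icc_self hy) (by
      dsimp only at h
      linarith)
  rw [← image_one_add_cos_div_two_Ioo, integral_image_eq_integral_abs_deriv_smul
    measurableSet_Ioo (fun θ _ ↦
      (((Real.hasDerivAt_cos θ).const_add 1).div_const 2).hasDerivWithinAt)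
    hinj, Real.Gamma_one_half_eq, show α + 1 / 2 + 1 / 2 = α + 1 by ring] at hB
  rw [intervalIntegral.integral_of_le Real.pi_pos.le, integral_Ioc_eq_integral_Ioo,
    mul_comm (Real.sqrt _), ← hB]
  refine setIntegral_congr_fun measurableSet_Ioo fun θ hθ ↦ ?_
  have hu : (1 + Real.cos θ) / 2 ∈ Ioo (0 : ℝ) 1 :=
    image_one_add_cos_div_two_Ioo ▸ mem_image_of_mem _ hθ
  have hs := Real.sin_pos_of_pos_of_lt_pi hθ.1 hθ.2
  have hsc := Real.sin_sq_add_cos_sq θ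
  set u := (1 + Real.cos θ) / 2 with hu_def
  have h_abs : |-Real.sin θ / 2| = u ^ (1 / 2 : ℝ) * (1 - u) ^ (1 / 2 : ℝ) := by
    rw [← Real.mul_rpow hu.1.le (by linarith [hu.2]), ← Real.sqrt_eq_rpow,
      ← Real.sqrt_sq_eq_abs]
    congr 1
    rw [hu_def]
    linear_combination hsc / 4
  have h1u : 0 < 1 - u := by linarith [hu.2]
  calc u ^ α = u ^ (1 / 2 + (α + 1 / 2 - 1)) * (1 - u) ^ ((1 / 2 : ℝ) + (1 / 2 - 1)) := by
        norm_num
        congr 1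
        ring
    _ = _ := by
        rw [Real.rpow_add hu.1, Real.rpow_add h1u, h_abs, smul_eq_mul]
        ring

lemma intervalIntegrable_one_add_cos_div_two_rpow_mul_cos {α : ℝ} (hα : 0 ≤ α) (c a b : ℝ) :
    IntervalIntegrable (fun θ ↦ ((1 + Real.cos θ) / 2) ^ α * Real.cos (c * θ))
      MeasureTheory.volume a b := by
  refine Continuous.intervalIntegrable (Continuous.mul ?_ (by fun_prop)) _ _
  exact Continuous.rpow_const (by fun_prop) fun _ ↦ Or.inr hα

/-- The recurrence in `n`, obtained by integrating the derivative of
`2 * cos (θ / 2) ^ (2 * α + 1) * sin ((2 * n + 1) * θ / 2)`. -/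
lemma integral_one_add_cos_div_two_rpow_mul_cos_succ {α : ℝ} (hα : 0 ≤ α) (n : ℕ) :
    (α + n + 1) *
        ∫ θ in (0 : ℝ)..Real.pi, ((1 + Real.cos θ) / 2) ^ α * Real.cos ((n + 1 : ℕ) * θ) =
      (α - n) * ∫ θ in (0 : ℝ)..Real.pi, ((1 + Real.cos θ) / 2) ^ α * Real.cos (n * θ) := by
  have hderiv : ∀ θ ∈ Set.uIcc 0 Real.pi, HasDerivAt
      (fun θ ↦ 2 * (Real.cos (θ / 2) ^ (2 * α + 1) * Real.sin ((2 * n + 1) * (θ / 2))))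
      ((α + n + 1) * (((1 + Real.cos θ) / 2) ^ α * Real.cos ((n + 1 : ℕ) * θ)) -
        (α - n) * (((1 + Real.cos θ) / 2) ^ α * Real.cos (n * θ))) θ := by
    intro θ hθ
    rw [Set.uIcc_of_le Real.pi_pos.le] at hθ
    have hc : 0 ≤ Real.cos (θ / 2) :=
      Real.cos_nonneg_of_mem_Icc ⟨by linarith [hθ.1, Real.pi_pos], by linarith [hθ.2]⟩
    have hhalf : HasDerivAt (fun θ : ℝ ↦ θ / 2) (1 / 2) θ := (hasDerivAt_id θ).div_const 2
    have hmain := ((hhalf.cos.rpow_const (p := 2 * α + 1) (Or.inr (by linarith))).mul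
      (hhalf.const_mul (2 * n + 1 : ℝ)).sin).const_mul 2
    refine hmain.congr_deriv ?_
    have hu : ((1 + Real.cos θ) / 2) ^ α = Real.cos (θ / 2) ^ (2 * α) := by
      rw [Real.rpow_mul hc, Real.rpow_two, Real.cos_sq]
      congr 1
      rw [show 2 * (θ / 2) = θ by ring]
      ring
    rw [hu, Real.rpow_add_one' hc (by linarith), show 2 * α + 1 - 1 = 2 * α by ring,
      show ((n + 1 : ℕ) : ℝ) * θ = (2 * n + 1) * (θ / 2) + θ / 2 by push_cast; ring,
      show (n : ℝ) * θ = (2 * n + 1) * (θ / 2) - θ / 2 by ring, Real.cos_add, Real.cos_sub]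
    ring
  have hint := fun c ↦ intervalIntegrable_one_add_cos_div_two_rpow_mul_cos hα c 0 Real.pi
  have h := intervalIntegral.integral_eq_sub_of_hasDerivAt hderiv
    (((hint _).const_mul _).sub ((hint _).const_mul _))
  rw [intervalIntegral.integral_sub ((hint _).const_mul _) ((hint _).const_mul _),
    intervalIntegral.integral_const_mul, intervalIntegral.integral_const_mul] at h
  simp only [Real.cos_pi_div_two, Real.zero_rpow (by linarith : 2 * α + 1 ≠ 0), zero_div,
    mul_zero, Real.sin_zero, zero_mul, sub_zero] at h
  exact sub_eq_zero.1 h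


/-- for every non-integer real `α > 0` and natural `n`,
`∫₀^π ((1 + cos θ)/2)^α · cos(nθ) dθ = √π · Γ(α+1/2) · Γ(α+1) / (Γ(α−n+1) · Γ(α+n+1))`. -/
theorem stmt12 (α : ℝ) (hα : 0 < α) (hαni : ∀ k : ℕ, α ≠ k) (n : ℕ) :
    ∫ θ in (0 : ℝ)..Real.pi, ((1 + Real.cos θ) / 2) ^ α * Real.cos (n * θ)
      = Real.sqrt Real.pi * Real.Gamma (α + 1 / 2) * Real.Gamma (α + 1) /
          (Real.Gamma (α - n + 1) * Real.Gamma (α + n + 1)) := by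
  induction n with
  | zero =>
    have hΓ : Real.Gamma (α + 1) ≠ 0 := (Real.Gamma_pos_of_pos (by linarith)).ne'
    simp only [Nat.cast_zero, zero_mul, Real.cos_zero, mul_one, sub_zero, add_zero]
    rw [integral_one_add_cos_div_two_rpow (by linarith)]
    field_simp
  | succ n ih =>
    have hn : (0 : ℝ) < α + n + 1 := by positivity
    have hsub : α - n ≠ 0 := sub_ne_zero.2 (hαni n)
    have hrec := integral_one_add_cos_div_two_rpow_mul_cos_succ hα.le n
    rw [ih, Real.Gamma_add_one hsub] at hrec
    have hadd : α + (n + 1 : ℕ) + 1 = (α + n + 1) + 1 := by push_cast; ring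
    have hsub' : α - (n + 1 : ℕ) + 1 = α - n := by push_cast; ring
    rw [hadd, hsub', Real.Gamma_add_one hn.ne', ← mul_right_inj' hn.ne', hrec]
    have hΓ : Real.Gamma (α - n) ≠ 0 := Real.Gamma_ne_zero fun m h ↦ by
      rcases le_total m n with hmn | hmn
      · refine hαni (n - m) ?_
        push_cast [hmn]
        linarith
      · have : (n : ℝ) ≤ m := by exact_mod_cast hmn
        linarith
    have hΓ' : Real.Gamma (α + n + 1) ≠ 0 := (Real.Gamma_pos_of_pos hn).ne'
    field_simp
end

section
/- Let α > 0 be a non-integer real, let m be an integer with m > α, let λ_max > 0, and let λ be a real number with 0 ≤ λ ≤ λ_max. Then |λ^α − f_m(λ)| ≤ λ_max^α · Γ(α+1/2) · Γ(α) / (π^{3/2} · (m−α)^{2α}). -/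
/-- Chebyshev coefficients of `x^α` on `[0, λ_max]`:
`c_k = 2·λ_max^α·Γ(α+1/2)·Γ(α+1)/(√π·Γ(α−k+1)·Γ(α+k+1))`. -/
noncomputable def chebCoeff (α lmax : ℝ) (k : ℕ) : ℝ :=
  2 * lmax ^ α * Real.Gamma (α + 1 / 2) * Real.Gamma (α + 1) /
    (Real.sqrt Real.pi * Real.Gamma (α - k + 1) * Real.Gamma (α + k + 1))

/-- Degree-`m` Chebyshev approximant of `x^α` on `[0, λ_max]`:
`f_m(x) = c₀/2 + Σ_{k=1}^m c_k·T_k(2x/λ_max − 1)`. -/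
noncomputable def chebApprox (α lmax : ℝ) (m : ℕ) (x : ℝ) : ℝ :=
  chebCoeff α lmax 0 / 2 +
    ∑ k ∈ Finset.Icc 1 m,
      chebCoeff α lmax k * (Polynomial.Chebyshev.T ℝ (k : ℤ)).eval (2 * x / lmax - 1)

open Real in
theorem betaIntegral_ofReal (u v : ℝ) :
    Complex.betaIntegral u v = ((∫ x in (0 : ℝ)..1, x ^ (u - 1) * (1 - x) ^ (v - 1) : ℝ) : ℂ) := by
  rw [Complex.betaIntegral, ← intervalIntegral.integral_ofReal]
  refine intervalIntegral.integral_congr fun x hx => ?_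
  rw [Set.uIcc_of_le zero_le_one] at hx
  have h1 : 0 ≤ 1 - x := by linarith [hx.2]
  push_cast [Complex.ofReal_cpow hx.1, Complex.ofReal_cpow h1]
  rfl

open Real in
theorem integral_cos_rpow {α : ℝ} (hα : 0 < α) :
    ∫ t in -(π / 2)..π / 2, cos t ^ (2 * α) = √π * Gamma (α + 1 / 2) / Gamma (α + 1) := by
  have hpi := pi_pos
  have hsub := intervalIntegral.integral_comp_mul_deriv_of_deriv_nonneg (a := -(π / 2)) (b := π / 2)
    (f := fun t => (1 + sin t) / 2) (f' := fun t => cos t / 2)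
    (g := fun x : ℝ => x ^ (α + 1 / 2 - 1) * (1 - x) ^ (α + 1 / 2 - 1))
    (by fun_prop)
    (fun x _ => by simpa using ((hasDerivAt_sin x).const_add 1).div_const 2)
    (fun x hx => by
      rw [min_eq_left (by linarith), max_eq_right (by linarith)] at hx
      have := cos_pos_of_mem_Ioo hx
      positivity)
  have hcongr : ∫ t in -(π / 2)..π / 2,
      ((fun x : ℝ => x ^ (α + 1 / 2 - 1) * (1 - x) ^ (α + 1 / 2 - 1)) ∘
        fun t => (1 + sin t) / 2) t * (cos t / 2)
      = ∫ t in -(π / 2)..π / 2, 4 ^ (-α) * cos t ^ (2 * α) := by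
    refine intervalIntegral.integral_congr fun t ht => ?_
    rw [Set.uIcc_of_le (by linarith)] at ht
    have hc := cos_nonneg_of_mem_Icc ht
    have h1 : 0 ≤ (1 + sin t) / 2 := by linarith [neg_one_le_sin t]
    have h2 : 0 ≤ 1 - (1 + sin t) / 2 := by linarith [sin_le_one t]
    have h3 : (1 + sin t) / 2 * (1 - (1 + sin t) / 2) = (cos t / 2) ^ (2 : ℝ) := by
      rw [rpow_two]; nlinarith [sin_sq_add_cos_sq t]
    simp only [Function.comp]
    rw [← mul_rpow h1 h2, h3, ← rpow_mul (by positivity)]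
    rcases hc.eq_or_lt with h0 | h0
    · rw [← h0, zero_rpow (by positivity : 2 * α ≠ 0)]; simp
    · have hp : 0 < cos t / 2 := by positivity
      conv_lhs => rw [← rpow_one (cos t / 2), ← rpow_mul hp.le, ← rpow_add hp]
      rw [show 1 * (2 * (α + 1 / 2 - 1)) + 1 = 2 * α by ring, div_rpow hc (by norm_num),
        rpow_mul zero_le_two 2 α, rpow_neg (by norm_num)]
      norm_num
      ring
  rw [hcongr, intervalIntegral.integral_const_mul] at hsub
  simp only [sin_neg, sin_pi_div_two] at hsub
  norm_num at hsub
  have hbeta := betaIntegral_ofReal (α + 1 / 2) (α + 1 / 2)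
  rw [Complex.betaIntegral_eq_Gamma_mul_div _ _ (by simp; positivity) (by simp; positivity),
    ← Complex.ofReal_add, Complex.Gamma_ofReal, Complex.Gamma_ofReal] at hbeta
  norm_cast at hbeta
  norm_num at hbeta
  rw [← hbeta] at hsub
  have hdup := Gamma_mul_Gamma_add_half (α + 1 / 2)
  rw [show 1 - 2 * (α + 1 / 2) = -(2 * α) by ring, rpow_neg (by norm_num),
    rpow_mul (by norm_num) 2 α, show α + 1 / 2 + 1 / 2 = α + 1 by ring,
    show 2 * (α + 1 / 2) = 2 * α + 1 by ring] at hdup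
  rw [rpow_neg (by norm_num), show α + 1 / 2 + (α + 1 / 2) = 2 * α + 1 by ring] at hsub
  norm_num at hdup
  generalize Gamma (α + 1 / 2) = G at *
  have g1 : 0 < Gamma (α + 1) := Gamma_pos_of_pos (by linarith)
  have g2 : 0 < Gamma (2 * α + 1) := Gamma_pos_of_pos (by linarith)
  have g3 : (0 : ℝ) < 4 ^ α := by positivity
  field_simp at hsub hdup ⊢
  apply mul_left_cancel₀ g2.ne'
  linear_combination Gamma (α + 1) * hsub + G * hdup

/-- The integrals `∫ cos(t)^(2α) e^(-2nit) dt` over a period. -/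
noncomputable def cosFourierIntegral (α : ℝ) (n : ℤ) : ℂ :=
  ∫ t in -(Real.pi / 2)..Real.pi / 2,
    ((Real.cos t ^ (2 * α) : ℝ) : ℂ) * Complex.exp (-(2 * n * t * Complex.I))

open Real in
theorem cosFourierIntegral_recurrence {α : ℝ} (hα : 0 < α) (n : ℤ) :
    (α + n + 1) * cosFourierIntegral α (n + 1) = (α - n) * cosFourierIntegral α n := by
  have hcont : ∀ k : ℤ, Continuous fun t : ℝ =>
      ((cos t ^ (2 * α) : ℝ) : ℂ) * Complex.exp (-(2 * k * t * Complex.I)) := fun k => by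
    refine (Complex.continuous_ofReal.comp
      (continuous_cos.rpow_const fun _ => Or.inr (by positivity))).mul (by fun_prop)
  have hderiv : ∀ t ∈ Set.uIcc (-(π / 2)) (π / 2), HasDerivAt
      (fun t : ℝ => ((cos t ^ (2 * α + 1) : ℝ) : ℂ) *
        Complex.exp (-((2 * n + 1) * t * Complex.I)))
      (Complex.I * ((α - n) * (((cos t ^ (2 * α) : ℝ) : ℂ) *
          Complex.exp (-(2 * n * t * Complex.I)))
        - (α + n + 1) * (((cos t ^ (2 * α) : ℝ) : ℂ) *
          Complex.exp (-(2 * (n + 1 : ℤ) * t * Complex.I))))) t := by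
    intro t ht
    rw [Set.uIcc_of_le (by linarith [pi_pos])] at ht
    have hc := cos_nonneg_of_mem_Icc ht
    have h1 := ((hasDerivAt_cos t).rpow_const (p := 2 * α + 1)
      (Or.inr (by linarith))).ofReal_comp
    have h2 : HasDerivAt (fun t : ℝ => Complex.exp (-((2 * n + 1) * t * Complex.I)))
        (Complex.exp (-((2 * n + 1) * t * Complex.I)) * (-((2 * n + 1) * Complex.I))) t := by
      refine HasDerivAt.cexp ?_
      convert! (((hasDerivAt_id t).ofReal_comp.const_mul (2 * n + 1 : ℂ)).mul_const
        Complex.I).neg using 1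
      simp
    convert! h1.mul h2 using 1
    have e1 : Complex.exp (-(2 * n * t * Complex.I)) =
        Complex.exp (-((2 * n + 1) * t * Complex.I)) * (Complex.cos t + Complex.sin t * Complex.I) := by
      rw [← Complex.exp_mul_I, ← Complex.exp_add]; congr 1; ring
    have e2 : Complex.exp (-(2 * (n + 1 : ℤ) * t * Complex.I)) =
        Complex.exp (-((2 * n + 1) * t * Complex.I)) * (Complex.cos t - Complex.sin t * Complex.I) := by
      rw [← Complex.cos_neg (t : ℂ), sub_eq_add_neg, ← neg_mul (Complex.sin t), ← Complex.sin_neg,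
        ← Complex.exp_mul_I, ← Complex.exp_add]
      congr 1; push_cast; ring
    rw [e1, e2, show 2 * α + 1 - 1 = 2 * α by ring, rpow_add_one' hc (by positivity)]
    push_cast
    linear_combination (-(2 * α + 1) * (((cos t ^ (2 * α) : ℝ) : ℂ)) * Complex.sin t *
      Complex.exp (-((2 * n + 1) * t * Complex.I)) * -1) * Complex.I_sq
  have hint := intervalIntegral.integral_eq_sub_of_hasDerivAt hderiv
    (Continuous.intervalIntegrable
      (((hcont n).const_mul _ |>.sub ((hcont (n + 1)).const_mul _)).const_mul _) _ _)
  rw [intervalIntegral.integral_const_mul, intervalIntegral.integral_sub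
    (Continuous.intervalIntegrable ((hcont n).const_mul _) _ _)
    (Continuous.intervalIntegrable ((hcont (n + 1)).const_mul _) _ _),
    intervalIntegral.integral_const_mul, intervalIntegral.integral_const_mul] at hint
  rw [cos_neg, cos_pi_div_two, zero_rpow (by positivity)] at hint
  simp only [Complex.ofReal_zero, zero_mul, sub_zero, mul_eq_zero, Complex.I_ne_zero,
    false_or] at hint
  exact (sub_eq_zero.1 hint).symm

open Real in
theorem cosFourierIntegral_eq {α : ℝ} (hα : 0 < α) (hni : ∀ k : ℤ, α ≠ k) (n : ℤ) :
    cosFourierIntegral α n =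
      ((√π * Gamma (α + 1 / 2) * Gamma (α + 1) /
        (Gamma (α - n + 1) * Gamma (α + n + 1)) : ℝ) : ℂ) := by
  have step : ∀ k : ℤ, Gamma (α - k + 1) * Gamma (α + k + 1) * (α + k + 1) =
      (α - k) * (Gamma (α - (k + 1 : ℤ) + 1) * Gamma (α + (k + 1 : ℤ) + 1)) := fun k => by
    have h1 : α - k ≠ 0 := sub_ne_zero.2 (hni k)
    have h2 : α + k + 1 ≠ 0 := fun h => hni (-(k + 1)) (by push_cast; linarith)
    rw [Gamma_add_one h1, show α + ((k + 1 : ℤ) : ℝ) + 1 = (α + k + 1) + 1 by push_cast; ring,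
      Gamma_add_one h2, show α - ((k + 1 : ℤ) : ℝ) + 1 = α - k by push_cast; ring]
    ring
  have gne : ∀ k : ℤ, Gamma (α - k + 1) * Gamma (α + k + 1) ≠ 0 := fun k =>
    mul_ne_zero
      (Gamma_ne_zero fun j h => hni (k - 1 - j) (by push_cast; linarith))
      (Gamma_ne_zero fun j h => hni (-k - 1 - j) (by push_cast; linarith))
  suffices h : cosFourierIntegral α n *
      ((Gamma (α - n + 1) * Gamma (α + n + 1) : ℝ) : ℂ) =
      ((√π * Gamma (α + 1 / 2) * Gamma (α + 1) : ℝ) : ℂ) by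
    rw [Complex.ofReal_div, eq_div_iff (by exact_mod_cast gne n), h]
  have inv : ∀ k : ℤ, cosFourierIntegral α (k + 1) *
      ((Gamma (α - (k + 1 : ℤ) + 1) * Gamma (α + (k + 1 : ℤ) + 1) : ℝ) : ℂ) =
      cosFourierIntegral α k * ((Gamma (α - k + 1) * Gamma (α + k + 1) : ℝ) : ℂ) := fun k => by
    have h1 : ((α : ℂ) - k) ≠ 0 := by exact_mod_cast sub_ne_zero.2 (hni k)
    have hs := congrArg (fun x : ℝ => (x : ℂ)) (step k)
    have hr := cosFourierIntegral_recurrence hα k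
    rw [Complex.ofReal_mul _ (α + k + 1), Complex.ofReal_mul (α - k)] at hs
    apply mul_left_cancel₀ h1
    rw [mul_left_comm]
    simp only [Complex.ofReal_sub, Complex.ofReal_add, Complex.ofReal_intCast,
      Complex.ofReal_one] at hs ⊢
    linear_combination -cosFourierIntegral α (k + 1) * hs +
      ((Gamma (α - k + 1) * Gamma (α + k + 1) : ℝ) : ℂ) * hr
  induction n using Int.induction_on with
  | zero =>
    have hg : Gamma (α + 1) ≠ 0 := (Gamma_pos_of_pos (by linarith)).ne'
    have h0 : cosFourierIntegral α 0 =
        ((√π * Gamma (α + 1 / 2) / Gamma (α + 1) : ℝ) : ℂ) := by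
      rw [← integral_cos_rpow hα, cosFourierIntegral, ← intervalIntegral.integral_ofReal]
      simp
    rw [h0, ← Complex.ofReal_mul]
    congr 1
    simp only [Int.cast_zero, sub_zero, add_zero]
    field_simp
  | succ k ih => rw [inv, ih]
  | pred k ih =>
    rw [← inv, sub_add_cancel, ih]

open Real in
theorem Gamma_div_Gamma_le {x s : ℝ} (hx : 1 < x) (hs : 0 < s) :
    Gamma x / Gamma (x + s) ≤ 1 / (x - 1) ^ s := by
  have hx' : 0 < x - 1 := by linarith
  have hG := Gamma_pos_of_pos (show 0 < x by linarith)
  have hG' := Gamma_pos_of_pos (show 0 < x + s by linarith)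
  have h := convexOn_log_Gamma.slope_mono_adjacent (x := x - 1) (y := x) (z := x + s)
    hx' (show 0 < x + s by linarith) (by linarith) (by linarith)
  simp only [Function.comp, sub_sub_cancel, add_sub_cancel_left, div_one] at h
  have e : Gamma x = (x - 1) * Gamma (x - 1) := by
    simpa using Gamma_add_one hx'.ne'
  have e' : log (Gamma x) = log (x - 1) + log (Gamma (x - 1)) := by
    rw [e, log_mul hx'.ne' (Gamma_pos_of_pos hx').ne']
  rw [e', add_sub_cancel_right, le_div_iff₀ hs, ← e'] at h
  rw [div_le_div_iff₀ hG' (by positivity), one_mul,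
    ← log_le_log_iff (by positivity) hG', log_mul hG.ne' (by positivity), log_rpow hx']
  linarith

open Real in
theorem abs_inv_Gamma_mul_Gamma_le {α x : ℝ} (hα : 0 < α) (hx : α < x) :
    |1 / (Gamma (α - x + 1) * Gamma (α + x + 1))| ≤
      1 / (2 * α * π) * (Gamma (x - α) / Gamma (x + α) -
        Gamma (x + 1 - α) / Gamma (x + 1 + α)) := by
  have h1 : 0 < Gamma (x - α) := Gamma_pos_of_pos (by linarith)
  have h2 : 0 < Gamma (x + α) := Gamma_pos_of_pos (by linarith)
  have hp := pi_pos
  have hxa : 0 < x + α := by linarith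
  have hxs : 0 < x - α := by linarith
  have hr := Real.Gamma_mul_Gamma_one_sub (x - α)
  rw [show 1 - (x - α) = α - x + 1 by ring] at hr
  rw [show α + x + 1 = x + α + 1 by ring, show x + 1 - α = x - α + 1 by ring,
    show x + 1 + α = x + α + 1 by ring, Gamma_add_one hxa.ne', Gamma_add_one hxs.ne']
  have e : 1 / (2 * α * π) * (Gamma (x - α) / Gamma (x + α) -
      (x - α) * Gamma (x - α) / ((x + α) * Gamma (x + α))) =
      Gamma (x - α) / (π * ((x + α) * Gamma (x + α))) := by
    field_simp; ring
  have e2 : 1 / (Gamma (α - x + 1) * ((x + α) * Gamma (x + α))) =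
      sin (π * (x - α)) * (Gamma (x - α) / (π * ((x + α) * Gamma (x + α)))) := by
    have : Gamma (α - x + 1) = π / sin (π * (x - α)) / Gamma (x - α) := by
      rw [← hr]; field_simp
    rw [this]; field_simp
  rw [e, e2, abs_mul, abs_of_pos (by positivity : 0 < Gamma (x - α) / _)]
  exact mul_le_of_le_one_left (by positivity) (abs_sin_le_one _)

theorem summable_and_abs_tsum_le_of_telescoping {a g : ℕ → ℝ}
    (hg : ∀ k, 0 ≤ g k) (ha : ∀ k, |a k| ≤ g k - g (k + 1)) :
    Summable a ∧ |∑' k, a k| ≤ g 0 := by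
  have hb : ∀ n, ∑ k ∈ Finset.range n, |a k| ≤ g 0 := fun n => by
    have := Finset.sum_le_sum (s := Finset.range n) fun k _ => ha k
    rw [Finset.sum_range_sub'] at this
    linarith [hg n]
  have hs : Summable fun k => |a k| := summable_of_sum_range_le (fun _ => abs_nonneg _) hb
  refine ⟨hs.of_abs, ?_⟩
  have h := norm_tsum_le_tsum_norm (f := a) hs
  exact h.trans (Real.tsum_le_of_sum_range_le (fun _ => abs_nonneg _) hb)

open Real in
theorem chebCoeff_eq_mul (α lmax : ℝ) (k : ℕ) :
    chebCoeff α lmax k = 2 * lmax ^ α * (Gamma (α + 1 / 2) * Gamma (α + 1) / √π) *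
      (1 / (Gamma (α - k + 1) * Gamma (α + k + 1))) := by
  rw [chebCoeff, mul_one_div, mul_div_assoc', div_div, mul_assoc (√π)]
  ring_nf

/-- The function `cos(t)^(2α)`, extended with period `π`. -/
noncomputable def absCosRpow {α : ℝ} (hα : 0 < α) : C(AddCircle Real.pi, ℂ) where
  toFun := Function.Periodic.lift (f := fun t : ℝ => ((|Real.cos t| ^ (2 * α) : ℝ) : ℂ))
    (fun t => by simp [Real.cos_add_pi])
  continuous_toFun := by
    refine continuous_coinduced_dom.mpr ?_
    exact Complex.continuous_ofReal.comp
      (Real.continuous_cos.abs.rpow_const fun _ => Or.inr (by positivity))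

theorem absCosRpow_coe {α : ℝ} (hα : 0 < α) (t : ℝ) :
    absCosRpow hα (t : AddCircle Real.pi) = ((|Real.cos t| ^ (2 * α) : ℝ) : ℂ) := rfl

open Real in
theorem fourierCoeff_absCosRpow [Fact (0 < π)] {α : ℝ} (hα : 0 < α) (hni : ∀ k : ℤ, α ≠ k)
    (n : ℤ) :
    fourierCoeff (absCosRpow hα) n =
      ((Gamma (α + 1 / 2) * Gamma (α + 1) / √π *
        (1 / (Gamma (α - n + 1) * Gamma (α + n + 1))) : ℝ) : ℂ) := by
  have h : ∫ x in -(π / 2)..-(π / 2) + π, fourier (-n) (x : AddCircle π) • absCosRpow hα x =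
      cosFourierIntegral α n := by
    rw [show -(π / 2) + π = π / 2 by ring]
    refine intervalIntegral.integral_congr fun t ht => ?_
    rw [Set.uIcc_of_le (by linarith [pi_pos])] at ht
    have hp : (π : ℂ) ≠ 0 := by exact_mod_cast pi_ne_zero
    simp only [absCosRpow_coe, abs_of_nonneg (cos_nonneg_of_mem_Icc ht), smul_eq_mul]
    rw [fourier_coe_apply, mul_comm]
    congr 2
    push_cast
    field_simp
  rw [fourierCoeff_eq_intervalIntegral _ _ (-(π / 2)), h, cosFourierIntegral_eq hα hni,
    Complex.real_smul, ← Complex.ofReal_mul]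
  congr 1
  have hs : √π ≠ 0 := by positivity
  have hsq : √π ^ 2 = π := sq_sqrt pi_pos.le
  rw [mul_one_div, ← mul_div_assoc]
  congr 1
  field_simp
  rw [hsq]

open Real in
theorem summable_inv_Gamma_mul_Gamma {α : ℝ} (hα : 0 < α) {m : ℕ} (hm : α < m) :
    Summable fun k : ℕ => 1 / (Gamma (α - k + 1) * Gamma (α + k + 1)) := by
  rw [← summable_nat_add_iff (m + 1)]
  refine (summable_and_abs_tsum_le_of_telescoping (g := fun k : ℕ => 1 / (2 * α * π) *
    (Gamma (((k + (m + 1) : ℕ) : ℝ) - α) / Gamma (((k + (m + 1) : ℕ) : ℝ) + α)))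
    (fun k => ?_) fun k => ?_).1
  · have h1 : 0 < Gamma (((k + (m + 1) : ℕ) : ℝ) - α) :=
      Gamma_pos_of_pos (by push_cast; linarith [(k.cast_nonneg : (0 : ℝ) ≤ k)])
    have h2 : 0 < Gamma (((k + (m + 1) : ℕ) : ℝ) + α) := Gamma_pos_of_pos (by positivity)
    positivity
  · have h := abs_inv_Gamma_mul_Gamma_le (x := ((k + (m + 1) : ℕ) : ℝ)) hα
      (by push_cast; linarith [(k.cast_nonneg : (0 : ℝ) ≤ k)])
    rw [mul_sub] at h
    convert h using 5 <;> (push_cast; ring)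

open Real in
theorem hasSum_abs_cos_rpow {α : ℝ} (hα : 0 < α) (hni : ∀ k : ℤ, α ≠ k) (t : ℝ) :
    HasSum (fun k : ℕ => 2 * (Gamma (α + 1 / 2) * Gamma (α + 1) / √π) *
        (1 / (Gamma (α - k + 1) * Gamma (α + k + 1))) * cos (2 * k * t))
      (|cos t| ^ (2 * α) + Gamma (α + 1 / 2) * Gamma (α + 1) / √π *
        (1 / (Gamma (α + 1) * Gamma (α + 1)))) := by
  have : Fact (0 < π) := ⟨pi_pos⟩
  obtain ⟨m, hm⟩ := exists_nat_gt α
  have hs := (summable_inv_Gamma_mul_Gamma hα hm).mul_left (Gamma (α + 1 / 2) * Gamma (α + 1) / √π)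
  have hsum : Summable (fourierCoeff (absCosRpow hα)) := by
    refine Summable.of_nat_of_neg ?_ ?_ <;> simp only [fourierCoeff_absCosRpow hα hni]
    · exact_mod_cast Complex.hasSum_ofReal.2 hs.hasSum |>.summable
    · refine (Complex.hasSum_ofReal.2 hs.hasSum).summable.congr fun k => ?_
      push_cast
      rw [sub_neg_eq_add, ← sub_eq_add_neg, mul_comm (Complex.ofReal (Gamma (α + k + 1)))]
  have h := (has_pointwise_sum_fourier_series_of_summable hsum (t : AddCircle π)).nat_add_neg
  rw [← Complex.hasSum_ofReal]
  convert! h using 1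
  · ext k
    have hp : (π : ℂ) ≠ 0 := by exact_mod_cast pi_ne_zero
    rw [fourierCoeff_absCosRpow hα hni, fourierCoeff_absCosRpow hα hni, fourier_coe_apply,
      fourier_coe_apply]
    have e1 : 2 * π * Complex.I * ((k : ℤ) : ℂ) * t / π = (2 * k * t : ℂ) * Complex.I := by
      push_cast; field_simp
    have e2 : 2 * π * Complex.I * ((-(k : ℤ) : ℤ) : ℂ) * t / π = -(2 * k * t : ℂ) * Complex.I := by
      push_cast; field_simp
    rw [e1, e2]
    have e3 := Complex.two_cos (x := (2 * k * t : ℂ))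
    have e4 : (α - ((-(k : ℤ) : ℤ) : ℝ) + 1) = α + k + 1 := by push_cast; ring
    have e5 : (α + ((-(k : ℤ) : ℤ) : ℝ) + 1) = α - k + 1 := by push_cast; ring
    rw [e4, e5, mul_comm (Gamma (α + k + 1)), smul_eq_mul, smul_eq_mul, Int.cast_natCast,
      ← mul_add, ← e3]
    push_cast
    ring
  · rw [fourierCoeff_absCosRpow hα hni, absCosRpow_coe, fourier_coe_apply]
    simp

open Real in
theorem chebApprox_eq_sum_range (α lmax : ℝ) (m : ℕ) (x : ℝ) :
    chebApprox α lmax m x = (∑ k ∈ Finset.range (m + 1),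
      chebCoeff α lmax k * (Polynomial.Chebyshev.T ℝ (k : ℤ)).eval (2 * x / lmax - 1)) -
      chebCoeff α lmax 0 / 2 := by
  rw [chebApprox, Finset.sum_range_eq_add_Ico _ (by omega), Finset.Ico_add_one_right_eq_Icc]
  simp
  ring

open Real in
theorem hasSum_chebCoeff_mul_T {α lmax lam : ℝ} (hα : 0 < α) (hni : ∀ k : ℤ, α ≠ k)
    (hlmax : 0 < lmax) (hlam : 0 ≤ lam) (hle : lam ≤ lmax) :
    HasSum (fun k : ℕ => chebCoeff α lmax k *
        (Polynomial.Chebyshev.T ℝ (k : ℤ)).eval (2 * lam / lmax - 1))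
      (lam ^ α + chebCoeff α lmax 0 / 2) := by
  have hx0 : 0 ≤ lam / lmax := by positivity
  have hx1 : √(lam / lmax) ≤ 1 := sqrt_le_one.2 ((div_le_one hlmax).2 hle)
  have hcos : cos (arccos √(lam / lmax)) = √(lam / lmax) :=
    cos_arccos (by linarith [sqrt_nonneg (lam / lmax)]) hx1
  have h := (hasSum_abs_cos_rpow hα hni (arccos √(lam / lmax))).mul_left (lmax ^ α)
  have hT : 2 * lam / lmax - 1 = cos (2 * arccos √(lam / lmax)) := by
    rw [cos_two_mul, hcos, sq_sqrt hx0]; ring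
  convert! h using 1
  · ext k
    rw [hT, Polynomial.Chebyshev.T_real_cos, chebCoeff_eq_mul]
    push_cast
    ring_nf
  · rw [hcos, abs_of_nonneg (sqrt_nonneg _), rpow_mul (sqrt_nonneg _), rpow_two, sq_sqrt hx0,
      div_rpow hlam hlmax.le, chebCoeff_eq_mul]
    have : lmax ^ α ≠ 0 := by positivity
    simp only [Nat.cast_zero, sub_zero, add_zero]
    rw [mul_add, mul_div_cancel₀ _ this]
    ring

/-- pointwise Chebyshev approximation error of `λ^α` on `[0, λ_max]`:
`|λ^α − f_m(λ)| ≤ λ_max^α·Γ(α+1/2)·Γ(α)/(π^{3/2}·(m−α)^{2α})` for non-integer `α > 0`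
and integer `m > α`. -/
theorem stmt13 (α : ℝ) (hα : 0 < α) (hαni : ∀ k : ℕ, α ≠ k) (m : ℕ) (hm : α < m)
    (lmax lam : ℝ) (hlmax : 0 < lmax) (hlam : 0 ≤ lam) (hle : lam ≤ lmax) :
    |lam ^ α - chebApprox α lmax m lam|
      ≤ lmax ^ α * Real.Gamma (α + 1 / 2) * Real.Gamma α /
          (Real.pi ^ ((3 : ℝ) / 2) * ((m : ℝ) - α) ^ (2 * α)) := by
  open Real in
  have hni : ∀ k : ℤ, α ≠ k := fun k h => by
    have hk : 0 ≤ k := by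
      have : (0 : ℝ) < k := h ▸ hα
      exact_mod_cast this.le
    lift k to ℕ using hk
    exact hαni k (by exact_mod_cast h)
  have hsum := hasSum_chebCoeff_mul_T hα hni hlmax hlam hle
  have htail := (hasSum_nat_add_iff' (m + 1)).2 hsum
  have hval : lam ^ α - chebApprox α lmax m lam = ∑' k : ℕ, chebCoeff α lmax (k + (m + 1)) *
      (Polynomial.Chebyshev.T ℝ ((k + (m + 1) : ℕ) : ℤ)).eval (2 * lam / lmax - 1) := by
    rw [htail.tsum_eq, chebApprox_eq_sum_range]; ring
  set C := 2 * lmax ^ α * (Gamma (α + 1 / 2) * Gamma (α + 1) / √π) with hC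
  have hg1 : 0 < Gamma (α + 1 / 2) := Gamma_pos_of_pos (by linarith)
  have hg2 : 0 < Gamma (α + 1) := Gamma_pos_of_pos (by linarith)
  have hg3 : 0 < Gamma α := Gamma_pos_of_pos hα
  have hpi := pi_pos
  have hC0 : 0 < C := by positivity
  have hT : ∀ k : ℕ, |(Polynomial.Chebyshev.T ℝ (k : ℤ)).eval (2 * lam / lmax - 1)| ≤ 1 := by
    intro k
    have h0 : 0 ≤ lam / lmax := by positivity
    have h1 : lam / lmax ≤ 1 := (div_le_one hlmax).2 hle
    rw [← cos_arccos (x := 2 * lam / lmax - 1) (by rw [mul_div_assoc]; linarith)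
      (by rw [mul_div_assoc]; linarith), Polynomial.Chebyshev.T_real_cos]
    exact abs_cos_le_one _
  have hbound := (summable_and_abs_tsum_le_of_telescoping
    (a := fun k : ℕ => chebCoeff α lmax (k + (m + 1)) *
      (Polynomial.Chebyshev.T ℝ ((k + (m + 1) : ℕ) : ℤ)).eval (2 * lam / lmax - 1))
    (g := fun k : ℕ => C * (1 / (2 * α * π) *
    (Gamma (((k + (m + 1) : ℕ) : ℝ) - α) / Gamma (((k + (m + 1) : ℕ) : ℝ) + α))))
    (fun k => ?_) fun k => ?_).2
  · rw [hval]
    refine hbound.trans ?_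
    have hr := Gamma_div_Gamma_le (x := m + 1 - α) (s := 2 * α) (by linarith) (by linarith)
    rw [show (m : ℝ) + 1 - α + 2 * α = m + 1 + α by ring,
      show (m : ℝ) + 1 - α - 1 = m - α by ring] at hr
    simp only [zero_add]
    push_cast
    have hma : 0 < ((m : ℝ) - α) ^ (2 * α) := rpow_pos_of_pos (by linarith) _
    calc C * (1 / (2 * α * π) * (Gamma (m + 1 - α) / Gamma (m + 1 + α)))
        ≤ C * (1 / (2 * α * π) * (1 / ((m : ℝ) - α) ^ (2 * α))) := by gcongr
      _ = _ := by
        have hp : π ^ ((3 : ℝ) / 2) = π * √π := by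
          rw [show (3 : ℝ) / 2 = 1 + 1 / 2 by norm_num, rpow_add hpi, rpow_one, sqrt_eq_rpow]
        rw [hp, hC, Gamma_add_one hα.ne']
        field_simp
  · have h1 : 0 < Gamma (((k + (m + 1) : ℕ) : ℝ) - α) :=
      Gamma_pos_of_pos (by push_cast; linarith [(k.cast_nonneg : (0 : ℝ) ≤ k)])
    have h2 : 0 < Gamma (((k + (m + 1) : ℕ) : ℝ) + α) := Gamma_pos_of_pos (by positivity)
    positivity
  · have h := abs_inv_Gamma_mul_Gamma_le (x := ((k + (m + 1) : ℕ) : ℝ)) hα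
      (by push_cast; linarith [(k.cast_nonneg : (0 : ℝ) ≤ k)])
    rw [abs_mul, chebCoeff_eq_mul, abs_mul, abs_of_pos hC0, ← mul_sub, ← mul_sub]
    refine (mul_le_of_le_one_right (by positivity) (hT _)).trans ?_
    gcongr
    convert! h using 5 <;> (push_cast; ring)
end

section
/- Let α > 0 be a non-integer real, let m be an integer with m > α, and let λ_max > 0. Then the series Σ_{k=m+1}^∞ |c_k| of absolute values of Chebyshev coefficients converges and satisfies Σ_{k=m+1}^∞ |c_k| ≤ λ_max^α · Γ(α+1/2) · Γ(α) / (π^{3/2} · (m−α)^{2α}). -/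
/-- Gautschi-type bound from log-convexity of the Gamma function. -/
theorem rpow_mul_Gamma_add_one_le {x s : ℝ} (hx : 0 < x) (hs : 0 < s) :
    x ^ s * Real.Gamma (x + 1) ≤ Real.Gamma (x + 1 + s) := by
  have hG := Real.Gamma_pos_of_pos hx
  have hG1 : 0 < Real.Gamma (x + 1) := Real.Gamma_pos_of_pos (by linarith)
  have hG2 : 0 < Real.Gamma (x + 1 + s) := Real.Gamma_pos_of_pos (by linarith)
  have hslope := Real.convexOn_log_Gamma.slope_mono_adjacent (x := x) (y := x + 1)
    (z := x + 1 + s) hx (show 0 < x + 1 + s by linarith) (by linarith) (by linarith)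
  simp only [Function.comp_apply, add_sub_cancel_left, div_one] at hslope
  rw [le_div_iff₀ hs] at hslope
  have hlog : Real.log (Real.Gamma (x + 1)) = Real.log x + Real.log (Real.Gamma x) := by
    rw [Real.Gamma_add_one hx.ne', Real.log_mul hx.ne' hG.ne']
  rw [← Real.log_le_log_iff (mul_pos (Real.rpow_pos_of_pos hx s) hG1) hG2,
    Real.log_mul (Real.rpow_pos_of_pos hx s).ne' hG1.ne', Real.log_rpow hx]
  rw [hlog] at hslope ⊢
  linarith

/-- A consequence of the reflection formula. -/
theorem inv_abs_Gamma_one_sub_le {s : ℝ} (hs : 0 < s) :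
    |Real.Gamma (1 - s)|⁻¹ ≤ Real.Gamma s / Real.pi := by
  have hG := Real.Gamma_pos_of_pos hs
  have h : Real.Gamma (1 - s) = Real.pi / Real.sin (Real.pi * s) / Real.Gamma s := by
    rw [← Real.Gamma_mul_Gamma_one_sub, mul_div_cancel_left₀ _ hG.ne']
  rw [h, abs_div, abs_div, abs_of_pos hG, abs_of_pos Real.pi_pos, inv_div, div_div_eq_mul_div]
  gcongr
  exact mul_le_of_le_one_right hG.le (Real.abs_sin_le_one _)

/-- Each Chebyshev coefficient beyond `α` is bounded by a telescoping difference. -/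
theorem abs_chebCoeff_le {α lmax : ℝ} (hα : 0 < α) (hlmax : 0 < lmax) {k : ℕ} (hk : α < k) :
    |chebCoeff α lmax k| ≤
      lmax ^ α * Real.Gamma (α + 1 / 2) * Real.Gamma α / Real.pi ^ ((3 : ℝ) / 2) *
        (Real.Gamma (k - α) / Real.Gamma (k + α) -
          Real.Gamma ((k + 1 : ℕ) - α) / Real.Gamma ((k + 1 : ℕ) + α)) := by
  have hsub : 0 < (k : ℝ) - α := sub_pos.2 hk
  have hadd : 0 < (k : ℝ) + α := by positivity
  have hG := Real.Gamma_pos_of_pos hα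
  have hGhalf : 0 < Real.Gamma (α + 1 / 2) := Real.Gamma_pos_of_pos (by linarith)
  have hGsub := Real.Gamma_pos_of_pos hsub
  have hGadd := Real.Gamma_pos_of_pos hadd
  have hpow := Real.rpow_pos_of_pos hlmax α
  have hsqrt := Real.sqrt_pos.2 Real.pi_pos
  have hpi : Real.pi ^ ((3 : ℝ) / 2) = Real.pi * √Real.pi := by
    rw [Real.sqrt_eq_rpow, show (3 : ℝ) / 2 = 1 + 1 / 2 by norm_num,
      Real.rpow_add Real.pi_pos, Real.rpow_one]
  have hinv := inv_abs_Gamma_one_sub_le hsub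
  have hpos : 0 < 2 * lmax ^ α * Real.Gamma (α + 1 / 2) * (α * Real.Gamma α) /
      (√Real.pi * ((k + α) * Real.Gamma (k + α))) := by positivity
  have hcoeff : chebCoeff α lmax k = 2 * lmax ^ α * Real.Gamma (α + 1 / 2) * (α * Real.Gamma α) /
      (√Real.pi * ((k + α) * Real.Gamma (k + α))) * (Real.Gamma (1 - (k - α)))⁻¹ := by
    rw [chebCoeff, Real.Gamma_add_one hα.ne', show α + k + 1 = (k + α) + 1 by ring,
      Real.Gamma_add_one hadd.ne', show α - k + 1 = 1 - (k - α) by ring, mul_right_comm √Real.pi,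
      ← div_div, div_eq_mul_inv]
  rw [hcoeff, abs_mul, abs_of_pos hpos, abs_inv]
  refine (mul_le_mul_of_nonneg_left hinv hpos.le).trans_eq ?_
  push_cast
  rw [show (k : ℝ) + 1 - α = (k - α) + 1 by ring, show (k : ℝ) + 1 + α = (k + α) + 1 by ring,
    Real.Gamma_add_one hsub.ne', Real.Gamma_add_one hadd.ne', hpi]
  field_simp
  ring

/-- the tail `Σ_{k=m+1}^∞ |c_k|` of the Chebyshev coefficients of `x^α` on
`[0, λ_max]` converges and is at most `λ_max^α·Γ(α+1/2)·Γ(α)/(π^{3/2}·(m−α)^{2α})`,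
for non-integer `α > 0` and integer `m > α`. -/
theorem stmt14 (α : ℝ) (hα : 0 < α) (hαni : ∀ k : ℕ, α ≠ k) (m : ℕ) (hm : α < m)
    (lmax : ℝ) (hlmax : 0 < lmax) :
    Summable (fun i : ℕ => |chebCoeff α lmax (m + 1 + i)|) ∧
    ∑' i : ℕ, |chebCoeff α lmax (m + 1 + i)|
      ≤ lmax ^ α * Real.Gamma (α + 1 / 2) * Real.Gamma α /
          (Real.pi ^ ((3 : ℝ) / 2) * ((m : ℝ) - α) ^ (2 * α)) := by
  set D := lmax ^ α * Real.Gamma (α + 1 / 2) * Real.Gamma α / Real.pi ^ ((3 : ℝ) / 2) with hD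
  set G : ℕ → ℝ := fun k => Real.Gamma (k - α) / Real.Gamma (k + α) with hG
  have hx : 0 < (m : ℝ) - α := sub_pos.2 hm
  have hDpos : 0 < D := by
    have := Real.Gamma_pos_of_pos hα
    have : 0 < Real.Gamma (α + 1 / 2) := Real.Gamma_pos_of_pos (by linarith)
    positivity
  have hlt (i : ℕ) : α < (m + 1 + i : ℕ) := by
    push_cast
    linarith [(Nat.cast_nonneg i : (0 : ℝ) ≤ i)]
  have hGnonneg (n : ℕ) : 0 ≤ G (m + 1 + n) :=
    (div_pos (Real.Gamma_pos_of_pos (sub_pos.2 (hlt n)))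
      (Real.Gamma_pos_of_pos (add_pos (hα.trans (hlt n)) hα))).le
  have hG0 : G (m + 1) ≤ (((m : ℝ) - α) ^ (2 * α))⁻¹ := by
    have h := rpow_mul_Gamma_add_one_le hx (s := 2 * α) (by linarith)
    have h1 : ((m + 1 : ℕ) : ℝ) - α = m - α + 1 := by push_cast; ring
    have h2 : ((m + 1 : ℕ) : ℝ) + α = m - α + 1 + 2 * α := by push_cast; ring
    simp only [hG, h1, h2]
    rw [div_le_iff₀ (Real.Gamma_pos_of_pos (by linarith)),
      le_inv_mul_iff₀ (Real.rpow_pos_of_pos hx _)]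
    exact h
  have hsum (n : ℕ) : ∑ i ∈ Finset.range n, |chebCoeff α lmax (m + 1 + i)| ≤
      lmax ^ α * Real.Gamma (α + 1 / 2) * Real.Gamma α /
        (Real.pi ^ ((3 : ℝ) / 2) * ((m : ℝ) - α) ^ (2 * α)) := by
    calc ∑ i ∈ Finset.range n, |chebCoeff α lmax (m + 1 + i)|
        ≤ ∑ i ∈ Finset.range n, D * (G (m + 1 + i) - G (m + 1 + (i + 1))) :=
          Finset.sum_le_sum fun i _ => abs_chebCoeff_le hα hlmax (hlt i)
      _ = D * (G (m + 1) - G (m + 1 + n)) := by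
          rw [← Finset.mul_sum, Finset.sum_range_sub' fun i => G (m + 1 + i), add_zero]
      _ ≤ D * (((m : ℝ) - α) ^ (2 * α))⁻¹ := by
          gcongr
          linarith [hGnonneg n]
      _ = _ := by rw [hD, ← div_eq_mul_inv, div_div]
  exact ⟨summable_of_sum_range_le (fun _ => abs_nonneg _) hsum,
    Real.tsum_le_of_sum_range_le (fun _ => abs_nonneg _) hsum⟩
end

section
/- Let G and G̃ be n×n real symmetric matrices with G positive definite and G̃ positive semi-definite, let α > 0 with α ≠ 1, and suppose √n · ‖G⁻¹‖₂ · ‖G − G̃‖₂ < 1. Then |S_α(G) − S_α(G̃)| ≤ |(α/(1−α)) · log₂(1 − √n · ‖G⁻¹‖₂ · ‖G − G̃‖₂)|. -/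
/-- Spectral norm (largest singular value) of a real square matrix, i.e. the operator norm
of the induced map on Euclidean space. -/
noncomputable def spectralNorm' {n : ℕ} (A : Matrix (Fin n) (Fin n) ℝ) : ℝ :=
  ‖Matrix.toEuclideanCLM (𝕜 := ℝ) A‖

open Matrix in
/-- The quadratic form of a real symmetric matrix, expanded in its orthonormal eigenbasis. -/
lemma inner_toEuclideanCLM_eq_sum_eigenvalues {ι : Type*} [Fintype ι] [DecidableEq ι]
    {A : Matrix ι ι ℝ} (hA : A.IsHermitian) (x : EuclideanSpace ℝ ι) :
    inner ℝ x (toEuclideanCLM (𝕜 := ℝ) A x)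
      = ∑ i, inner ℝ (hA.eigenvectorBasis i) x ^ 2 * hA.eigenvalues i := by
  have hE (i : ι) : toEuclideanCLM (𝕜 := ℝ) A (hA.eigenvectorBasis i)
      = hA.eigenvalues i • hA.eigenvectorBasis i := by
    ext1
    simpa using congrFun (hA.mulVec_eigenvectorBasis i) _
  conv_lhs => rw [← hA.eigenvectorBasis.sum_repr' x, map_sum]
  simp_rw [map_smul, hE, hA.eigenvectorBasis.sum_repr', inner_sum, inner_smul_right]
  refine Finset.sum_congr rfl fun i _ => ?_
  rw [real_inner_comm x]
  ring

/-- The Loewner order bound `A ≤ c • B` passes to `tr A ^ p ≤ c ^ p * tr B ^ p`. -/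
lemma sum_eigenvalues_rpow_le {ι : Type*} [Fintype ι] [DecidableEq ι] {A B : Matrix ι ι ℝ}
    (hA : A.PosSemidef) (hB : B.PosSemidef) {c p : ℝ} (hc : 0 ≤ c) (hp : 0 < p)
    (h : ∀ x, inner ℝ x (Matrix.toEuclideanCLM (𝕜 := ℝ) A x)
      ≤ c * inner ℝ x (Matrix.toEuclideanCLM (𝕜 := ℝ) B x)) :
    ∑ i, hA.isHermitian.eigenvalues i ^ p ≤ c ^ p * ∑ i, hB.isHermitian.eigenvalues i ^ p := by
  set a := hA.isHermitian.eigenvalues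
  set b := hB.isHermitian.eigenvalues
  set u := hA.isHermitian.eigenvectorBasis
  set v := hB.isHermitian.eigenvectorBasis
  have ha (i : ι) : 0 ≤ a i := hA.eigenvalues_nonneg i
  have hb (i : ι) : 0 ≤ b i := hB.eigenvalues_nonneg i
  let w (i j : ι) : ℝ := inner ℝ (u i) (v j) ^ 2
  have hw (i j : ι) : 0 ≤ w i j := sq_nonneg _
  have hw₁ (j : ι) : ∑ i, w i j = 1 := by
    simpa [w] using u.sum_sq_norm_inner_right (v j)
  have hw₂ (i : ι) : ∑ j, w i j = 1 := by
    simpa [w] using v.sum_sq_norm_inner_left (u i)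
  have hau (i : ι) : inner ℝ (u i) (Matrix.toEuclideanCLM (𝕜 := ℝ) A (u i)) = a i := by
    rw [inner_toEuclideanCLM_eq_sum_eigenvalues hA.isHermitian]
    simp [u, a, OrthonormalBasis.inner_eq_ite]
  have hbv (j : ι) : inner ℝ (v j) (Matrix.toEuclideanCLM (𝕜 := ℝ) B (v j)) = b j := by
    rw [inner_toEuclideanCLM_eq_sum_eigenvalues hB.isHermitian]
    simp [v, b, OrthonormalBasis.inner_eq_ite]
  rw [Finset.mul_sum]
  rcases le_total 1 p with h1 | h1
  · have key (i : ι) : a i ^ p ≤ ∑ j, w i j * (c ^ p * b j ^ p) := by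
      have h2 : a i ≤ ∑ j, w i j * (c * b j) := by
        have h3 := h (u i)
        rw [hau, inner_toEuclideanCLM_eq_sum_eigenvalues hB.isHermitian, Finset.mul_sum] at h3
        refine h3.trans_eq (Finset.sum_congr rfl fun j _ => ?_)
        simp only [w, b, v, u]
        rw [real_inner_comm]
        ring
      refine (Real.rpow_le_rpow (ha i) h2 hp.le).trans ?_
      refine (Real.rpow_arith_mean_le_arith_mean_rpow _ _ _ (fun j _ => hw i j) (hw₂ i)
        (fun j _ => mul_nonneg hc (hb j)) h1).trans_eq ?_
      simp_rw [Real.mul_rpow hc (hb _)]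
    refine (Finset.sum_le_sum fun i _ => key i).trans_eq ?_
    rw [Finset.sum_comm]
    simp_rw [← Finset.sum_mul, hw₁, one_mul]
  · have key (j : ι) : ∑ i, w i j * a i ^ p ≤ c ^ p * b j ^ p := by
      have h2 : ∑ i, w i j * a i ≤ c * b j := by
        have h3 := h (v j)
        rwa [hbv, inner_toEuclideanCLM_eq_sum_eigenvalues hA.isHermitian] at h3
      rw [← Real.mul_rpow hc (hb j)]
      refine le_trans ?_ (Real.rpow_le_rpow
        (Finset.sum_nonneg fun i _ => mul_nonneg (hw i j) (ha i)) h2 hp.le)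
      simpa using (Real.concaveOn_rpow hp.le h1).le_map_sum (t := Finset.univ)
        (w := fun i => w i j) (p := a) (fun i _ => hw i j) (hw₁ j) (fun i _ => ha i)
    refine le_trans (le_of_eq ?_) (Finset.sum_le_sum fun j _ => key j)
    rw [Finset.sum_comm]
    simp_rw [← Finset.sum_mul, hw₂, one_mul]

open Matrix in
/-- A positive definite matrix is bounded below by the reciprocal norm of its inverse. -/
lemma norm_sq_le_norm_inv_mul_inner {ι : Type*} [Fintype ι] [DecidableEq ι]
    {A : Matrix ι ι ℝ} (hA : A.PosDef) (x : EuclideanSpace ℝ ι) :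
    ‖x‖ ^ 2 ≤ ‖toEuclideanCLM (𝕜 := ℝ) A⁻¹‖ * inner ℝ x (toEuclideanCLM (𝕜 := ℝ) A x) := by
  set u := hA.isHermitian.eigenvectorBasis
  have hu (i : ι) : 1 ≤ ‖toEuclideanCLM (𝕜 := ℝ) A⁻¹‖ * hA.isHermitian.eigenvalues i := by
    have hE : toEuclideanCLM (𝕜 := ℝ) A (u i) = hA.isHermitian.eigenvalues i • u i := by
      ext1
      simpa using congrFun (hA.isHermitian.mulVec_eigenvectorBasis i) _
    have hinv : toEuclideanCLM (𝕜 := ℝ) A⁻¹ (toEuclideanCLM (𝕜 := ℝ) A (u i)) = u i := by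
      rw [← mul_apply_eq_comp, ← map_mul,
        nonsing_inv_mul _ hA.det_pos.ne'.isUnit, map_one, one_apply_eq_self]
    have h := (toEuclideanCLM (𝕜 := ℝ) A⁻¹).le_opNorm (toEuclideanCLM (𝕜 := ℝ) A (u i))
    rwa [hinv, hE, norm_smul, u.norm_eq_one, mul_one, Real.norm_of_nonneg
      (hA.eigenvalues_pos i).le] at h
  rw [inner_toEuclideanCLM_eq_sum_eigenvalues hA.isHermitian, Finset.mul_sum,
    ← u.sum_sq_norm_inner_right x]
  refine Finset.sum_le_sum fun i _ => ?_
  rw [Real.norm_eq_abs, sq_abs, mul_left_comm]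
  exact le_mul_of_one_le_right (sq_nonneg _) (hu i)

/-- entropy perturbation bound. For `G` symmetric positive definite and `G̃`
symmetric PSD with `√n·‖G⁻¹‖₂·‖G − G̃‖₂ < 1`, the matrix-based Rényi entropies satisfy
`|S_α(G) − S_α(G̃)| ≤ |(α/(1−α))·log₂(1 − √n·‖G⁻¹‖₂·‖G − G̃‖₂)|`. -/
theorem stmt15 {n : ℕ} (G G' : Matrix (Fin n) (Fin n) ℝ)
    (hG : G.PosDef) (hG' : G'.PosSemidef)
    (α : ℝ) (hα : 0 < α) (hα1 : α ≠ 1)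
    (hpert : Real.sqrt n * spectralNorm' G⁻¹ * spectralNorm' (G - G') < 1) :
    |(1 / (1 - α)) * Real.logb 2 (∑ i, hG.isHermitian.eigenvalues i ^ α)
      - (1 / (1 - α)) * Real.logb 2 (∑ i, hG'.isHermitian.eigenvalues i ^ α)|
      ≤ |(α / (1 - α)) *
          Real.logb 2 (1 - Real.sqrt n * spectralNorm' G⁻¹ * spectralNorm' (G - G'))| := by
  rcases Nat.eq_zero_or_pos n with rfl | hn
  · simp
  set t := Real.sqrt n * spectralNorm' G⁻¹ * spectralNorm' (G - G') with ht
  have ht0 : 0 ≤ t := by unfold t spectralNorm'; positivity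
  have hs : 0 < 1 - t := by linarith
  have hform (x : EuclideanSpace ℝ (Fin n)) :
      |inner ℝ x (Matrix.toEuclideanCLM (𝕜 := ℝ) G x)
        - inner ℝ x (Matrix.toEuclideanCLM (𝕜 := ℝ) G' x)|
        ≤ t * inner ℝ x (Matrix.toEuclideanCLM (𝕜 := ℝ) G x) := by
    have h1 := norm_sq_le_norm_inv_mul_inner hG x
    have h2 : |inner ℝ x (Matrix.toEuclideanCLM (𝕜 := ℝ) (G - G') x)|
        ≤ spectralNorm' (G - G') * ‖x‖ ^ 2 := by
      refine (abs_real_inner_le_norm _ _).trans ?_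
      have := mul_le_mul_of_nonneg_left
        ((Matrix.toEuclideanCLM (𝕜 := ℝ) (G - G')).le_opNorm x) (norm_nonneg x)
      unfold spectralNorm'
      linarith
    rw [map_sub, sub_apply, inner_sub_right] at h2
    have hsqrt : 1 ≤ Real.sqrt n := Real.one_le_sqrt.mpr (by exact_mod_cast hn)
    have hδ : 0 ≤ spectralNorm' (G - G') := norm_nonneg _
    calc _ ≤ spectralNorm' (G - G') * ‖x‖ ^ 2 := h2
      _ ≤ spectralNorm' (G - G') * (spectralNorm' G⁻¹
            * inner ℝ x (Matrix.toEuclideanCLM (𝕜 := ℝ) G x)) :=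
          mul_le_mul_of_nonneg_left h1 hδ
      _ ≤ Real.sqrt n * (spectralNorm' (G - G') * (spectralNorm' G⁻¹
            * inner ℝ x (Matrix.toEuclideanCLM (𝕜 := ℝ) G x))) :=
          le_mul_of_one_le_left (mul_nonneg hδ ((sq_nonneg _).trans h1)) hsqrt
      _ = _ := by rw [ht]; ring
  have hGx (x : EuclideanSpace ℝ (Fin n)) :
      0 ≤ inner ℝ x (Matrix.toEuclideanCLM (𝕜 := ℝ) G x) := by
    rw [inner_toEuclideanCLM_eq_sum_eigenvalues hG.isHermitian]
    exact Finset.sum_nonneg fun i _ => mul_nonneg (sq_nonneg _) (hG.eigenvalues_pos i).le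
  have hle := sum_eigenvalues_rpow_le hG.posSemidef hG' (inv_pos.mpr hs).le hα fun x => by
    rw [inv_mul_eq_div, le_div_iff₀ hs]
    linarith [abs_le.mp (hform x)]
  have hge := sum_eigenvalues_rpow_le hG' hG.posSemidef (inv_pos.mpr hs).le hα fun x => by
    rw [inv_mul_eq_div, le_div_iff₀ hs]
    have h1 := (abs_le.mp (hform x)).1
    have h2 := mul_le_mul_of_nonneg_right
      (show inner ℝ x (Matrix.toEuclideanCLM (𝕜 := ℝ) G' x)
        ≤ (1 + t) * inner ℝ x (Matrix.toEuclideanCLM (𝕜 := ℝ) G x) by linarith) hs.le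
    nlinarith [mul_nonneg (sq_nonneg t) (hGx x)]
  have : Nonempty (Fin n) := ⟨⟨0, hn⟩⟩
  have hpos : 0 < ∑ i, hG.isHermitian.eigenvalues i ^ α :=
    Finset.sum_pos (fun i _ => Real.rpow_pos_of_pos (hG.eigenvalues_pos i) α)
      Finset.univ_nonempty
  have hc : 0 < (1 - t)⁻¹ ^ α := Real.rpow_pos_of_pos (inv_pos.mpr hs) α
  have hpos' : 0 < ∑ i, hG'.isHermitian.eigenvalues i ^ α :=
    pos_of_mul_pos_right (hpos.trans_le hle) hc.le
  have hlogc : Real.logb 2 ((1 - t)⁻¹ ^ α) = -(α * Real.logb 2 (1 - t)) := by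
    rw [Real.logb_rpow_eq_mul_logb_of_pos (inv_pos.mpr hs), Real.logb_inv, mul_neg]
  have h1 := Real.logb_le_logb_of_le one_lt_two hpos hle
  have h2 := Real.logb_le_logb_of_le one_lt_two hpos' hge
  rw [Real.logb_mul hc.ne' hpos'.ne', hlogc] at h1
  rw [Real.logb_mul hc.ne' hpos.ne', hlogc] at h2
  rw [← mul_sub, div_eq_mul_one_div α, mul_comm α, mul_assoc, abs_mul, abs_mul]
  refine mul_le_mul_of_nonneg_left (le_trans ?_ (neg_le_abs _)) (abs_nonneg _)
  rw [abs_le]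
  constructor <;> linarith
end

section
/- Let A and Ã be n×n real symmetric matrices with A invertible, and set E = Ã − A. Let λ₁,…,λₙ and μ₁,…,μₙ be the eigenvalues (with multiplicity) of A and Ã respectively. Then there exists a permutation τ of {1,…,n} such that for every i, |μ_{τ(i)} − λ_i| ≤ √n · ‖A⁻¹‖₂ · ‖E‖₂ · |λ_i|. -/
open scoped RealInnerProductSpace

section Weyl

variable {ι E : Type*} [Fintype ι] [NormedAddCommGroup E] [InnerProductSpace ℝ E]

/-- The quadratic form of a symmetric operator in an orthonormal eigenbasis. -/
theorem inner_apply_self_eq_sum_eigenvalues {T : E →ₗ[ℝ] E} (hT : T.IsSymmetric)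
    (b : OrthonormalBasis ι ℝ E) (l : ι → ℝ) (hb : ∀ j, T (b j) = l j • b j) (x : E) :
    ⟪x, T x⟫ = ∑ j, l j * ⟪b j, x⟫ ^ 2 := by
  rw [← b.sum_inner_mul_inner]
  refine Finset.sum_congr rfl fun j _ => ?_
  rw [← hT (b j) x, hb, real_inner_smul_left, real_inner_comm x]
  ring

/-- Two orthonormal bases, with the vectors of each distributed so that every index other than `i`
is constrained at most once, leave a common nonzero orthogonal vector. -/
theorem exists_ne_zero_inner_eq_zero (b c : OrthonormalBasis ι ℝ E) (i : ι) (P Q : ι → Prop)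
    (hPi : ¬P i) (hQi : ¬Q i) (hPQ : ∀ j, ¬(P j ∧ Q j)) :
    ∃ x : E, x ≠ 0 ∧ (∀ j, P j → ⟪b j, x⟫ = 0) ∧ ∀ j, Q j → ⟪c j, x⟫ = 0 := by
  classical
  have := b.toBasis.finiteDimensional_of_finite
  let f : E →ₗ[ℝ] (ι → ℝ) := LinearMap.pi fun j =>
    if P j then innerₗ E (b j) else if Q j then innerₗ E (c j) else 0
  have hdim : Module.finrank ℝ E = Module.finrank ℝ (ι → ℝ) := by
    simp [Module.finrank_eq_card_basis b.toBasis]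
  have hf : ¬Function.Injective f := by
    rw [LinearMap.injective_iff_surjective_of_finrank_eq_finrank hdim]
    intro hs
    obtain ⟨x, hx⟩ := hs (Pi.single i 1)
    simpa [f, hPi, hQi] using congrFun hx i
  rw [← LinearMap.ker_eq_bot, Submodule.eq_bot_iff] at hf
  push Not at hf
  obtain ⟨x, hx, hx0⟩ := hf
  have hfx (j : ι) : f x j = 0 := congrFun hx j
  refine ⟨x, hx0, fun j hj => ?_, fun j hj => ?_⟩
  · simpa [f, hj] using hfx j
  · have hPj : ¬P j := fun h => hPQ j ⟨h, hj⟩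
    simpa [f, hj, hPj] using hfx j

/-- One half of **Weyl's perturbation inequality**: eigenvalues listed in decreasing order move up
by at most the norm of the perturbation. -/
theorem eigenvalue_le_add_opNorm_sub [LinearOrder ι] {S T : E →L[ℝ] E}
    (hS : (S : E →ₗ[ℝ] E).IsSymmetric) (hT : (T : E →ₗ[ℝ] E).IsSymmetric)
    (b c : OrthonormalBasis ι ℝ E) {l m : ι → ℝ} (hl : Antitone l) (hm : Antitone m)
    (hb : ∀ j, S (b j) = l j • b j) (hc : ∀ j, T (c j) = m j • c j) (i : ι) :
    m i ≤ l i + ‖T - S‖ := by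
  obtain ⟨x, hx0, hxb, hxc⟩ := exists_ne_zero_inner_eq_zero b c i (· < i) (i < ·)
    (lt_irrefl i) (lt_irrefl i) fun j h => lt_asymm h.1 h.2
  have hSx : ⟪x, S x⟫ ≤ l i * ‖x‖ ^ 2 := by
    have h := inner_apply_self_eq_sum_eigenvalues hS b l hb x
    rw [ContinuousLinearMap.coe_coe] at h
    rw [h, ← b.sum_sq_inner_right, Finset.mul_sum]
    refine Finset.sum_le_sum fun j _ => ?_
    rcases lt_or_ge j i with hj | hj
    · simp [hxb j hj]
    · exact mul_le_mul_of_nonneg_right (hl hj) (sq_nonneg _)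
  have hTx : m i * ‖x‖ ^ 2 ≤ ⟪x, T x⟫ := by
    have h := inner_apply_self_eq_sum_eigenvalues hT c m hc x
    rw [ContinuousLinearMap.coe_coe] at h
    rw [h, ← c.sum_sq_inner_right, Finset.mul_sum]
    refine Finset.sum_le_sum fun j _ => ?_
    rcases lt_or_ge i j with hj | hj
    · simp [hxc j hj]
    · exact mul_le_mul_of_nonneg_right (hm hj) (sq_nonneg _)
  have hTS : ⟪x, T x⟫ - ⟪x, S x⟫ ≤ ‖T - S‖ * ‖x‖ ^ 2 := by
    rw [← inner_sub_right, ← sub_apply]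
    calc ⟪x, (T - S) x⟫ ≤ ‖x‖ * ‖(T - S) x‖ := real_inner_le_norm _ _
      _ ≤ ‖x‖ * (‖T - S‖ * ‖x‖) := by gcongr; exact (T - S).le_opNorm x
      _ = ‖T - S‖ * ‖x‖ ^ 2 := by ring
  have hx : 0 < ‖x‖ ^ 2 := by positivity
  exact le_of_mul_le_mul_right (by linarith) hx

end Weyl

namespace Matrix.IsHermitian

variable {n : Type*} [Fintype n] [DecidableEq n] {A B : Matrix n n ℝ}

theorem toEuclideanCLM_eigenvectorBasis (hA : A.IsHermitian) (j : n) :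
    toEuclideanCLM (𝕜 := ℝ) A (hA.eigenvectorBasis j)
      = hA.eigenvalues j • hA.eigenvectorBasis j := by
  ext k
  simpa using congrFun (hA.mulVec_eigenvectorBasis j) k

theorem eigenvalues_le_add_opNorm_sub (hA : A.IsHermitian) (hB : B.IsHermitian) (i : n) :
    hB.eigenvalues i ≤ hA.eigenvalues i + ‖toEuclideanCLM (𝕜 := ℝ) (B - A)‖ := by
  let e : Fin (Fintype.card n) ≃ n := Fintype.equivOfCardEq (Fintype.card_fin _)
  have hbasis {M : Matrix n n ℝ} (hM : M.IsHermitian) (j : Fin (Fintype.card n)) :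
      toEuclideanCLM (𝕜 := ℝ) M ((hM.eigenvectorBasis.reindex e.symm) j)
        = hM.eigenvalues₀ j • (hM.eigenvectorBasis.reindex e.symm) j := by
    simpa [eigenvalues, e] using hM.toEuclideanCLM_eigenvectorBasis (e j)
  have h := eigenvalue_le_add_opNorm_sub (isSymmetric_toEuclideanLin_iff.mpr hA)
    (isSymmetric_toEuclideanLin_iff.mpr hB) _ _ hA.eigenvalues₀_antitone hB.eigenvalues₀_antitone
    (hbasis hA) (hbasis hB) (e.symm i)
  rwa [← map_sub] at h

/-- **Weyl's perturbation inequality** for real symmetric matrices. -/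
theorem abs_eigenvalues_sub_le_opNorm_sub (hA : A.IsHermitian) (hB : B.IsHermitian) (i : n) :
    |hB.eigenvalues i - hA.eigenvalues i| ≤ ‖toEuclideanCLM (𝕜 := ℝ) (B - A)‖ := by
  have h₁ := hA.eigenvalues_le_add_opNorm_sub hB i
  have h₂ := hB.eigenvalues_le_add_opNorm_sub hA i
  rw [← neg_sub B A, map_neg, norm_neg] at h₂
  rw [abs_le]
  constructor <;> linarith

theorem one_le_opNorm_inv_mul_abs_eigenvalues (hA : A.IsHermitian) (hdet : IsUnit A.det) (i : n) :
    1 ≤ ‖toEuclideanCLM (𝕜 := ℝ) A⁻¹‖ * |hA.eigenvalues i| := by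
  let v := hA.eigenvectorBasis i
  have hv : ‖v‖ = 1 := hA.eigenvectorBasis.orthonormal.1 i
  have hinv : toEuclideanCLM (𝕜 := ℝ) A⁻¹ (toEuclideanCLM (𝕜 := ℝ) A v) = v := by
    rw [← mul_apply_eq_comp, ← map_mul, nonsing_inv_mul _ hdet, map_one,
      one_apply_eq_self]
  have h := (toEuclideanCLM (𝕜 := ℝ) A⁻¹).le_opNorm (toEuclideanCLM (𝕜 := ℝ) A v)
  rwa [hinv, hA.toEuclideanCLM_eigenvectorBasis, norm_smul, hv, mul_one, Real.norm_eq_abs] at h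

end Matrix.IsHermitian

/-- relative eigenvalue perturbation bound (symmetric case of Li's lemma).
For symmetric `A` (invertible) and symmetric `Ã = A + E`, there is a permutation `τ` with
`|μ_{τ(i)} − λ_i| ≤ √n·‖A⁻¹‖₂·‖E‖₂·|λ_i|` for all `i`. -/
theorem stmt16 {n : ℕ} (A B : Matrix (Fin n) (Fin n) ℝ)
    (hA : A.IsHermitian) (hB : B.IsHermitian) (hAinv : IsUnit A.det) :
    ∃ τ : Equiv.Perm (Fin n), ∀ i : Fin n,
      |hB.eigenvalues (τ i) - hA.eigenvalues i|
        ≤ Real.sqrt n * spectralNorm' A⁻¹ * spectralNorm' (B - A) * |hA.eigenvalues i| := by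
  refine ⟨Equiv.refl _, fun i => ?_⟩
  have hsqrt : 1 ≤ Real.sqrt n := by
    rw [Real.one_le_sqrt]
    exact_mod_cast i.pos
  have hinv : 1 ≤ spectralNorm' A⁻¹ * |hA.eigenvalues i| :=
    hA.one_le_opNorm_inv_mul_abs_eigenvalues hAinv i
  have hE : 0 ≤ spectralNorm' (B - A) := norm_nonneg _
  calc |hB.eigenvalues i - hA.eigenvalues i|
      ≤ spectralNorm' (B - A) := hA.abs_eigenvalues_sub_le_opNorm_sub hB i
    _ ≤ Real.sqrt n * (spectralNorm' A⁻¹ * |hA.eigenvalues i|) * spectralNorm' (B - A) :=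
      le_mul_of_one_le_left hE (one_le_mul_of_one_le_of_one_le hsqrt hinv)
    _ = _ := by ring
end

section
/- Let x₁,…,xₙ ∈ ℝ^d, let f : ℝ^d → ℝ be Lipschitz with constant L with respect to the Euclidean norm and satisfy f(0) > 0, and define G_{ij} = f(x_i − x_j)/(n·f(0)) for 1 ≤ i,j ≤ n and R = L/(n·f(0)). Let V₁,…,V_c be a partition of {1,…,n} into nonempty sets. Then D^kernel({V_s}) ≥ 1/(2n) − R² · D^kmeans({V_s}), where D^kernel({V_s}) = Σ_{s=1}^c (1/|V_s|) · Σ_{i∈V_s} Σ_{j∈V_s} G_{ij}² and D^kmeans({V_s}) = Σ_{s=1}^c (1/|V_s|) · Σ_{i∈V_s} Σ_{j∈V_s} ‖x_i − x_j‖₂². -/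
/-- If the finite sets `V s` cover `Fin n`, their cardinalities add up to at least `n`. -/
theorem le_sum_card_of_cover {n c : ℕ} {V : Fin c → Finset (Fin n)}
    (hcover : ∀ i, ∃ s, i ∈ V s) : (n : ℝ) ≤ ∑ s, ((V s).card : ℝ) := by
  have hU : Finset.univ.biUnion V = Finset.univ := by
    ext i
    simpa using hcover i
  have hle : (Finset.univ.biUnion V).card ≤ ∑ s, (V s).card := Finset.card_biUnion_le
  rw [hU, Finset.card_univ, Fintype.card_fin] at hle
  exact_mod_cast hle

/-- The normalized kernel value and the scaled distance cannot both be small. -/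
theorem inv_two_mul_sq_le_of_lipschitz {E : Type*} [NormedAddCommGroup E] {f : E → ℝ} {L : ℝ}
    (hLip : ∀ a b : E, |f a - f b| ≤ L * ‖a - b‖) (hf0 : 0 < f 0) (n : ℕ) (v : E) :
    1 / (2 * (n : ℝ) ^ 2) ≤ (f v / (n * f 0)) ^ 2 + (L / (n * f 0)) ^ 2 * ‖v‖ ^ 2 := by
  rcases Nat.eq_zero_or_pos n with rfl | hn
  · simp
  have hn' : (0 : ℝ) < n := by exact_mod_cast hn
  have hv : f 0 ≤ f v + L * ‖v‖ := by
    have h := (abs_le.mp (hLip v 0)).1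
    rw [sub_zero] at h
    linarith
  have hsq : f 0 ^ 2 ≤ 2 * (f v ^ 2 + (L * ‖v‖) ^ 2) :=
    (pow_le_pow_left₀ hf0.le hv 2).trans add_sq_le
  have hrhs : (f v / (n * f 0)) ^ 2 + (L / (n * f 0)) ^ 2 * ‖v‖ ^ 2
      = (f v ^ 2 + (L * ‖v‖) ^ 2) / (n * f 0) ^ 2 := by
    ring
  rw [hrhs, div_le_div_iff₀ (by positivity) (by positivity)]
  nlinarith [mul_le_mul_of_nonneg_left hsq (sq_nonneg (n : ℝ))]


/-- for a shift-invariant `L`-Lipschitz kernel `φ(x,y) = f(x−y)` with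
`f(0) > 0`, normalized kernel matrix `G_{ij} = f(x_i − x_j)/(n·f(0))` and `R = L/(n·f(0))`,
any partition `V₁,…,V_c` of the samples into nonempty clusters satisfies
`D^kernel ≥ 1/(2n) − R²·D^kmeans`. -/
theorem stmt17 {d n c : ℕ} (x : Fin n → EuclideanSpace ℝ (Fin d))
    (f : EuclideanSpace ℝ (Fin d) → ℝ) (L : ℝ)
    (hLip : ∀ a b : EuclideanSpace ℝ (Fin d), |f a - f b| ≤ L * ‖a - b‖)
    (hf0 : 0 < f 0)
    (V : Fin c → Finset (Fin n)) (hV : ∀ s, (V s).Nonempty)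
    (hdisj : ∀ s t, s ≠ t → Disjoint (V s) (V t))
    (hcover : ∀ i, ∃ s, i ∈ V s)
    (G : Fin n → Fin n → ℝ) (hG : ∀ i j, G i j = f (x i - x j) / (n * f 0))
    (R : ℝ) (hR : R = L / (n * f 0)) :
    1 / (2 * (n : ℝ))
      - R ^ 2 * ∑ s, (1 / ((V s).card : ℝ)) * ∑ i ∈ V s, ∑ j ∈ V s, ‖x i - x j‖ ^ 2
    ≤ ∑ s, (1 / ((V s).card : ℝ)) * ∑ i ∈ V s, ∑ j ∈ V s, (G i j) ^ 2 := by
  subst hR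
  rw [sub_le_iff_le_add, Finset.mul_sum, ← Finset.sum_add_distrib]
  have hcluster : ∀ s, ((V s).card : ℝ) * (1 / (2 * (n : ℝ) ^ 2)) ≤
      (1 / ((V s).card : ℝ)) * ∑ i ∈ V s, ∑ j ∈ V s, (G i j) ^ 2
        + (L / (n * f 0)) ^ 2 *
          ((1 / ((V s).card : ℝ)) * ∑ i ∈ V s, ∑ j ∈ V s, ‖x i - x j‖ ^ 2) := by
    intro s
    have hcard : (0 : ℝ) < (V s).card := by exact_mod_cast (hV s).card_pos
    calc ((V s).card : ℝ) * (1 / (2 * (n : ℝ) ^ 2))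
        = (1 / ((V s).card : ℝ)) * ∑ i ∈ V s, ∑ j ∈ V s, 1 / (2 * (n : ℝ) ^ 2) := by
          simp only [Finset.sum_const, nsmul_eq_mul]
          rw [← mul_assoc, one_div_mul_cancel hcard.ne', one_mul]
      _ ≤ (1 / ((V s).card : ℝ)) * ∑ i ∈ V s, ∑ j ∈ V s,
            ((G i j) ^ 2 + (L / (n * f 0)) ^ 2 * ‖x i - x j‖ ^ 2) := by
          gcongr with i _ j _
          rw [hG]
          exact inv_two_mul_sq_le_of_lipschitz hLip hf0 n (x i - x j)
      _ = _ := by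
          simp only [Finset.sum_add_distrib, ← Finset.mul_sum]
          ring
  refine le_trans ?_ (Finset.sum_le_sum fun s _ => hcluster s)
  rw [← Finset.sum_mul]
  calc 1 / (2 * (n : ℝ)) = n * (1 / (2 * (n : ℝ) ^ 2)) := by
        rcases eq_or_ne (n : ℝ) 0 with h | h
        · simp [h]
        · field_simp
    _ ≤ _ := by
        gcongr
        exact le_sum_card_of_cover hcover
end

section
/- Let G be an n×n real matrix, let V₁,…,V_c be a partition of {1,…,n} into nonempty sets with associated radii 0 ≤ r₁ ≤ r₂ ≤ … ≤ r_c, and let L ≥ 0, and k, d ≥ 1. Suppose G̃ is an n×n real matrix that agrees with G on every diagonal block (i.e. G̃_{ij} = G_{ij} whenever i, j ∈ V_s for some s), and whose off-diagonal blocks satisfy, for all s ≠ t, (Σ_{i∈V_s} Σ_{j∈V_t} (G_{ij} − G̃_{ij})²)^{1/2} ≤ 4·L·k^{−1/d}·√(|V_s|·|V_t|)·min(r_s, r_t). Then ‖G − G̃‖_F ≤ 4·L·k^{−1/d}·√(2r), where r = Σ_{i=1}^c r_i²·|V_i|·Σ_{j=i+1}^c |V_j|. -/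
/-- Frobenius norm of a real square matrix. -/
noncomputable def frobNorm {n : ℕ} (A : Matrix (Fin n) (Fin n) ℝ) : ℝ :=
  Real.sqrt (∑ i, ∑ j, (A i j) ^ 2)

/-- A sum over a finite type splits along a partition into finsets. -/
theorem sum_univ_eq_sum_sum_of_partition {ι κ M : Type*} [Fintype ι] [Fintype κ]
    [AddCommMonoid M] (V : κ → Finset ι) (hdisj : ∀ s t, s ≠ t → Disjoint (V s) (V t))
    (hcover : ∀ i, ∃ s, i ∈ V s) (f : ι → M) :
    ∑ i, f i = ∑ s, ∑ i ∈ V s, f i := by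
  classical
  rw [← Finset.sum_biUnion fun s _ t _ h => hdisj s t h]
  congr 1
  ext i
  simpa using hcover i

/-- The sum of a matrix with vanishing diagonal is bounded by pairing the entries
above and below the diagonal. -/
theorem sum_sum_le_sum_Ioi_of_diag_eq_zero {c : ℕ} (F B : Fin c → Fin c → ℝ)
    (hdiag : ∀ s, F s s = 0) (hB : ∀ s t, s < t → F s t ≤ B s t ∧ F t s ≤ B s t) :
    ∑ s, ∑ t, F s t ≤ 2 * ∑ s, ∑ t ∈ Finset.Ioi s, B s t := by
  have hoffdiag : ∑ s, ∑ t, F s t = ∑ s, ∑ t ∈ Finset.Ioi s, (F t s + F s t) := by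
    rw [Finset.sum_sum_Ioi_add_eq_sum_sum_off_diag, Finset.sum_comm]
    refine Finset.sum_congr rfl fun s _ => ?_
    rw [← Finset.sum_add_sum_compl {s} fun t => F t s, Finset.sum_singleton, hdiag, zero_add]
  simp_rw [hoffdiag, Finset.mul_sum]
  refine Finset.sum_le_sum fun s _ => Finset.sum_le_sum fun t ht => ?_
  have := hB s t (Finset.mem_Ioi.mp ht)
  linarith

/-- block low-rank approximation error. If `G̃` agrees with `G` on diagonal
blocks of a partition `V₁,…,V_c` (with radii `0 ≤ r₁ ≤ … ≤ r_c`) and each off-diagonal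
block satisfies the rank-`k` error guarantee
`‖(G − G̃)^{(s,t)}‖_F ≤ 4·L·k^{−1/d}·√(|V_s||V_t|)·min(r_s,r_t)`, then
`‖G − G̃‖_F ≤ 4·L·k^{−1/d}·√(2r)` with `r = Σᵢ rᵢ²·|Vᵢ|·Σ_{j>i} |Vⱼ|`. -/
theorem stmt18 {n c : ℕ} (G G' : Matrix (Fin n) (Fin n) ℝ)
    (V : Fin c → Finset (Fin n)) (hV : ∀ s, (V s).Nonempty)
    (hdisj : ∀ s t, s ≠ t → Disjoint (V s) (V t))
    (hcover : ∀ i, ∃ s, i ∈ V s)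
    (rad : Fin c → ℝ) (hrad0 : ∀ i, 0 ≤ rad i) (hradmono : Monotone rad)
    (L : ℝ) (hL : 0 ≤ L) (k d : ℕ) (hk : 1 ≤ k) (hd : 1 ≤ d)
    (hdiag : ∀ s : Fin c, ∀ i ∈ V s, ∀ j ∈ V s, G' i j = G i j)
    (hoff : ∀ s t : Fin c, s ≠ t →
      Real.sqrt (∑ i ∈ V s, ∑ j ∈ V t, (G i j - G' i j) ^ 2)
        ≤ 4 * L * (k : ℝ) ^ (-(1 : ℝ) / d) *
            Real.sqrt (((V s).card : ℝ) * ((V t).card : ℝ)) * min (rad s) (rad t))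
    (r : ℝ)
    (hr : r = ∑ i, (rad i) ^ 2 * ((V i).card : ℝ) * ∑ j ∈ Finset.Ioi i, ((V j).card : ℝ)) :
    frobNorm (G - G') ≤ 4 * L * (k : ℝ) ^ (-(1 : ℝ) / d) * Real.sqrt (2 * r) := by
  set K : ℝ := 4 * L * (k : ℝ) ^ (-(1 : ℝ) / d)
  have hK : 0 ≤ K := by positivity
  have hblock : ∀ s t, s ≠ t → ∑ i ∈ V s, ∑ j ∈ V t, (G i j - G' i j) ^ 2 ≤
      K ^ 2 * (((V s).card : ℝ) * ((V t).card : ℝ)) * min (rad s) (rad t) ^ 2 := by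
    intro s t hst
    have hmin : 0 ≤ min (rad s) (rad t) := le_min (hrad0 s) (hrad0 t)
    have h := (Real.sqrt_le_left (by positivity)).mp (hoff s t hst)
    rwa [mul_pow, mul_pow, Real.sq_sqrt (by positivity)] at h
  have hsplit : ∑ i, ∑ j, ((G - G') i j) ^ 2 =
      ∑ s, ∑ t, ∑ i ∈ V s, ∑ j ∈ V t, (G i j - G' i j) ^ 2 := by
    rw [sum_univ_eq_sum_sum_of_partition V hdisj hcover]
    refine Finset.sum_congr rfl fun s _ => ?_
    rw [Finset.sum_comm (s := Finset.univ) (t := V s)]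
    refine Finset.sum_congr rfl fun i _ => ?_
    exact sum_univ_eq_sum_sum_of_partition V hdisj hcover _
  have hbound : ∑ i, ∑ j, ((G - G') i j) ^ 2 ≤ K ^ 2 * (2 * r) := by
    rw [hsplit]
    refine (sum_sum_le_sum_Ioi_of_diag_eq_zero _
      (fun s t => K ^ 2 * (((V s).card : ℝ) * ((V t).card : ℝ)) * rad s ^ 2) ?_ ?_).trans_eq ?_
    · exact fun s => Finset.sum_eq_zero fun i hi => Finset.sum_eq_zero fun j hj => by
        rw [hdiag s i hi j hj, sub_self, zero_pow two_ne_zero]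
    · intro s t hst
      have hle := hradmono hst.le
      have h₁ := hblock s t hst.ne
      have h₂ := hblock t s hst.ne'
      rw [min_eq_left hle] at h₁
      rw [min_eq_right hle, mul_comm ((V t).card : ℝ)] at h₂
      exact ⟨h₁, h₂⟩
    · rw [hr, mul_left_comm]
      congr 1
      simp_rw [Finset.mul_sum]
      exact Finset.sum_congr rfl fun s _ => Finset.sum_congr rfl fun t _ => by ring
  calc frobNorm (G - G') ≤ Real.sqrt (K ^ 2 * (2 * r)) := Real.sqrt_le_sqrt hbound
    _ = K * Real.sqrt (2 * r) := by rw [Real.sqrt_mul (sq_nonneg K), Real.sqrt_sq hK]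
end

section
/- Let G and G̃ be n×n real symmetric matrices with G positive definite and G̃ positive semi-definite, let α > 0 with α ≠ 1, let L ≥ 0, k, d ≥ 1 and r ≥ 0, and suppose ‖G − G̃‖_F ≤ 4·√(2r)·L·k^{−1/d} and 4·√(2rn)·L·k^{−1/d}·‖G⁻¹‖₂ < 1. Then |S_α(G) − S_α(G̃)| ≤ |(α/(1−α)) · log₂(1 − 4·√(2rn)·L·k^{−1/d}·‖G⁻¹‖₂)|. -/
open Matrix in
theorem Matrix.IsHermitian.dotProduct_mulVec_eq_sum_eigenvalues {n : ℕ}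
    {A : Matrix (Fin n) (Fin n) ℝ} (hA : A.IsHermitian) (x : EuclideanSpace ℝ (Fin n)) :
    x.ofLp ⬝ᵥ A *ᵥ x.ofLp =
      ∑ j, hA.eigenvalues j * inner ℝ (hA.eigenvectorBasis j) x ^ 2 := by
  rw [← inner_toEuclideanCLM, ← hA.eigenvectorBasis.sum_inner_mul_inner]
  refine Finset.sum_congr rfl fun j _ => ?_
  have h : inner ℝ (hA.eigenvectorBasis j) (toEuclideanCLM (𝕜 := ℝ) A x) =
      hA.eigenvalues j * inner ℝ (hA.eigenvectorBasis j) x := by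
    rw [inner_toEuclideanCLM, dotProduct_mulVec, ← mulVec_transpose,
      ← conjTranspose_eq_transpose_of_trivial, hA.eq, hA.mulVec_eigenvectorBasis,
      smul_dotProduct, EuclideanSpace.inner_eq_star_dotProduct, star_trivial,
      dotProduct_comm x.ofLp, smul_eq_mul]
  rw [h, real_inner_comm]
  ring

theorem Matrix.IsHermitian.sum_inner_eigenvectorBasis_sq {n : ℕ}
    {A : Matrix (Fin n) (Fin n) ℝ} (hA : A.IsHermitian) (x : EuclideanSpace ℝ (Fin n)) :
    ∑ j, inner ℝ (hA.eigenvectorBasis j) x ^ 2 = ‖x‖ ^ 2 := by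
  simpa using hA.eigenvectorBasis.sum_sq_norm_inner_right x

open Matrix in
/-- **Weyl monotonicity**, with a scaling factor. Both families of eigenvalues are arranged in the
same way, since `Matrix.IsHermitian.eigenvalues` reindexes the sorted eigenvalues by a bijection
that does not depend on the matrix. -/
theorem Matrix.IsHermitian.mul_eigenvalues_le_eigenvalues {n : ℕ}
    {A B : Matrix (Fin n) (Fin n) ℝ} (hA : A.IsHermitian) (hB : B.IsHermitian) {c : ℝ}
    (hc : 0 ≤ c)
    (h : ∀ x : EuclideanSpace ℝ (Fin n),
      c * (x.ofLp ⬝ᵥ A *ᵥ x.ofLp) ≤ x.ofLp ⬝ᵥ B *ᵥ x.ofLp) (i : Fin n) :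
    c * hA.eigenvalues i ≤ hB.eigenvalues i := by
  classical
  let p : Fin n → Fin (Fintype.card (Fin n)) :=
    (Fintype.equivOfCardEq (Fintype.card_fin _)).symm
  have hp : Function.Injective p := Equiv.injective _
  -- `n - 1` linear conditions on `x` leave only the eigenvectors of `A` up to index `i` and those
  -- of `B` from index `i` on.
  let φ : EuclideanSpace ℝ (Fin n) →ₗ[ℝ] ({j : Fin n // j ≠ i} → ℝ) :=
    LinearMap.pi fun j => if p i < p j then (innerSL ℝ (hA.eigenvectorBasis j)).toLinearMap
      else (innerSL ℝ (hB.eigenvectorBasis j)).toLinearMap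
  have hker : LinearMap.ker φ ≠ ⊥ := by
    apply LinearMap.ker_ne_bot_of_finrank_lt
    have : 0 < n := i.pos
    simp [Fintype.card_subtype_compl]
    omega
  obtain ⟨x, hx, hx0⟩ := Submodule.exists_mem_ne_zero_of_ne_bot hker
  have hφ (j : Fin n) (hj : j ≠ i) : φ x ⟨j, hj⟩ = 0 := by
    rw [LinearMap.mem_ker.mp hx]; rfl
  have hAx (j : Fin n) (hj : p i < p j) : inner ℝ (hA.eigenvectorBasis j) x = 0 := by
    simpa [φ, hj] using hφ j (by rintro rfl; exact lt_irrefl _ hj)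
  have hBx (j : Fin n) (hj : p j < p i) : inner ℝ (hB.eigenvectorBasis j) x = 0 := by
    simpa [φ, hj.not_gt] using hφ j (by rintro rfl; exact lt_irrefl _ hj)
  have hlow : hA.eigenvalues i * ‖x‖ ^ 2 ≤ x.ofLp ⬝ᵥ A *ᵥ x.ofLp := by
    rw [hA.dotProduct_mulVec_eq_sum_eigenvalues, ← hA.sum_inner_eigenvectorBasis_sq,
      Finset.mul_sum]
    refine Finset.sum_le_sum fun j _ => ?_
    rcases lt_or_ge (p i) (p j) with hj | hj
    · simp [hAx j hj]
    · exact mul_le_mul_of_nonneg_right (hA.eigenvalues₀_antitone hj) (sq_nonneg _)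
  have hupp : x.ofLp ⬝ᵥ B *ᵥ x.ofLp ≤ hB.eigenvalues i * ‖x‖ ^ 2 := by
    rw [hB.dotProduct_mulVec_eq_sum_eigenvalues, ← hB.sum_inner_eigenvectorBasis_sq,
      Finset.mul_sum]
    refine Finset.sum_le_sum fun j _ => ?_
    rcases lt_or_ge (p j) (p i) with hj | hj
    · simp [hBx j hj]
    · exact mul_le_mul_of_nonneg_right (hB.eigenvalues₀_antitone hj) (sq_nonneg _)
  have hx2 : 0 < ‖x‖ ^ 2 := by positivity
  refine le_of_mul_le_mul_right ?_ hx2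
  calc c * hA.eigenvalues i * ‖x‖ ^ 2 = c * (hA.eigenvalues i * ‖x‖ ^ 2) := by ring
    _ ≤ c * (x.ofLp ⬝ᵥ A *ᵥ x.ofLp) := mul_le_mul_of_nonneg_left hlow hc
    _ ≤ _ := (h x).trans hupp

open Matrix in
theorem abs_dotProduct_mulVec_le_frobNorm {n : ℕ} (E : Matrix (Fin n) (Fin n) ℝ)
    (x : EuclideanSpace ℝ (Fin n)) :
    |x.ofLp ⬝ᵥ E *ᵥ x.ofLp| ≤ frobNorm E * ‖x‖ ^ 2 := by
  have hE : ‖toEuclideanCLM (𝕜 := ℝ) E x‖ ≤ frobNorm E * ‖x‖ := by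
    refine le_of_sq_le_sq ?_ (mul_nonneg (Real.sqrt_nonneg _) (norm_nonneg _))
    rw [mul_pow, frobNorm, Real.sq_sqrt (by positivity), EuclideanSpace.real_norm_sq_eq,
      EuclideanSpace.real_norm_sq_eq, Finset.sum_mul]
    refine Finset.sum_le_sum fun i _ => ?_
    rw [ofLp_toEuclideanCLM]
    exact Finset.sum_mul_sq_le_sq_mul_sq Finset.univ (E i) x.ofLp
  rw [← inner_toEuclideanCLM]
  calc _ ≤ ‖x‖ * ‖toEuclideanCLM (𝕜 := ℝ) E x‖ := abs_real_inner_le_norm _ _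
    _ ≤ ‖x‖ * (frobNorm E * ‖x‖) := by gcongr
    _ = _ := by ring

open Matrix in
theorem Matrix.PosDef.one_le_spectralNorm'_inv_mul_eigenvalues {n : ℕ}
    {G : Matrix (Fin n) (Fin n) ℝ} (hG : G.PosDef) (i : Fin n) :
    1 ≤ spectralNorm' G⁻¹ * hG.isHermitian.eigenvalues i := by
  set u := hG.isHermitian.eigenvectorBasis i
  have hu1 : ‖u‖ = 1 := hG.isHermitian.eigenvectorBasis.norm_eq_one i
  have hpos := hG.eigenvalues_pos i
  have h1 : hG.isHermitian.eigenvalues i • toEuclideanCLM (𝕜 := ℝ) G⁻¹ u = u := by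
    have hdet : IsUnit G.det := hG.det_pos.ne'.isUnit
    ext1
    rw [WithLp.ofLp_smul, ofLp_toEuclideanCLM, ← mulVec_smul,
      ← hG.isHermitian.mulVec_eigenvectorBasis, mulVec_mulVec, nonsing_inv_mul _ hdet, one_mulVec]
  calc (1 : ℝ) = ‖hG.isHermitian.eigenvalues i • toEuclideanCLM (𝕜 := ℝ) G⁻¹ u‖ := by
        rw [h1, hu1]
    _ = hG.isHermitian.eigenvalues i * ‖toEuclideanCLM (𝕜 := ℝ) G⁻¹ u‖ := by
        rw [norm_smul, Real.norm_of_nonneg hpos.le]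
    _ ≤ hG.isHermitian.eigenvalues i * (spectralNorm' G⁻¹ * ‖u‖) := by
        gcongr
        exact ContinuousLinearMap.le_opNorm _ _
    _ = _ := by rw [hu1]; ring

open Matrix in
theorem Matrix.PosDef.norm_sq_le_spectralNorm'_inv_mul {n : ℕ}
    {G : Matrix (Fin n) (Fin n) ℝ} (hG : G.PosDef) (x : EuclideanSpace ℝ (Fin n)) :
    ‖x‖ ^ 2 ≤ spectralNorm' G⁻¹ * (x.ofLp ⬝ᵥ G *ᵥ x.ofLp) := by
  rw [hG.isHermitian.dotProduct_mulVec_eq_sum_eigenvalues,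
    ← hG.isHermitian.sum_inner_eigenvectorBasis_sq, Finset.mul_sum]
  refine Finset.sum_le_sum fun j _ => ?_
  rw [← mul_assoc]
  exact le_mul_of_one_le_left (sq_nonneg _) (hG.one_le_spectralNorm'_inv_mul_eigenvalues j)

theorem rpow_mul_sum_rpow_le {ι : Type*} [Fintype ι] {f g : ι → ℝ} {c α : ℝ} (hc : 0 ≤ c)
    (hα : 0 ≤ α) (hf : ∀ i, 0 ≤ f i) (h : ∀ i, c * f i ≤ g i) :
    c ^ α * ∑ i, f i ^ α ≤ ∑ i, g i ^ α := by
  rw [Finset.mul_sum]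
  refine Finset.sum_le_sum fun i _ => ?_
  rw [← Real.mul_rpow hc (hf i)]
  exact Real.rpow_le_rpow (mul_nonneg hc (hf i)) (h i) hα

theorem abs_logb_two_sub_logb_two_le {a b c α : ℝ} (ha : 0 < a) (hc : 0 < c)
    (hab : c ^ α * a ≤ b) (hba : c ^ α * b ≤ a) :
    |Real.logb 2 a - Real.logb 2 b| ≤ |α * Real.logb 2 c| := by
  have hcα : 0 < c ^ α := Real.rpow_pos_of_pos hc α
  have hb : 0 < b := (mul_pos hcα ha).trans_le hab
  have key {s t : ℝ} (hs : 0 < s) (h : c ^ α * s ≤ t) :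
      α * Real.logb 2 c + Real.logb 2 s ≤ Real.logb 2 t := by
    rw [← Real.logb_rpow_eq_mul_logb_of_pos hc, ← Real.logb_mul hcα.ne' hs.ne']
    exact Real.logb_le_logb_of_le one_lt_two (mul_pos hcα hs) h
  refine le_trans ?_ (neg_le_abs _)
  rw [abs_le]
  constructor <;> linarith [key ha hab, key hb hba]

/-- Rényi entropy error of block low-rank approximation. If
`‖G − G̃‖_F ≤ 4·√(2r)·L·k^{−1/d}` and `4·√(2rn)·L·k^{−1/d}·‖G⁻¹‖₂ < 1`, then
`|S_α(G) − S_α(G̃)| ≤ |(α/(1−α))·log₂(1 − 4·√(2rn)·L·k^{−1/d}·‖G⁻¹‖₂)|`. -/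
theorem stmt19 {n : ℕ} (G G' : Matrix (Fin n) (Fin n) ℝ)
    (hG : G.PosDef) (hG' : G'.PosSemidef)
    (α : ℝ) (hα : 0 < α) (hα1 : α ≠ 1)
    (L : ℝ) (hL : 0 ≤ L) (k d : ℕ) (hk : 1 ≤ k) (hd : 1 ≤ d) (r : ℝ) (hr : 0 ≤ r)
    (hF : frobNorm (G - G') ≤ 4 * Real.sqrt (2 * r) * L * (k : ℝ) ^ (-(1 : ℝ) / d))
    (hsmall : 4 * Real.sqrt (2 * r * n) * L * (k : ℝ) ^ (-(1 : ℝ) / d) * spectralNorm' G⁻¹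
        < 1) :
    |(1 / (1 - α)) * Real.logb 2 (∑ i, hG.isHermitian.eigenvalues i ^ α)
      - (1 / (1 - α)) * Real.logb 2 (∑ i, hG'.isHermitian.eigenvalues i ^ α)|
      ≤ |(α / (1 - α)) * Real.logb 2
          (1 - 4 * Real.sqrt (2 * r * n) * L * (k : ℝ) ^ (-(1 : ℝ) / d) *
            spectralNorm' G⁻¹)| := by
  rcases Nat.eq_zero_or_pos n with rfl | hn
  · simp
  set ε := 4 * Real.sqrt (2 * r * n) * L * (k : ℝ) ^ (-(1 : ℝ) / d) * spectralNorm' G⁻¹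
  have hsn : 0 ≤ spectralNorm' G⁻¹ := norm_nonneg _
  have hε0 : 0 ≤ ε := by positivity
  have hn1 : (1 : ℝ) ≤ n := by exact_mod_cast hn
  have hF' : frobNorm (G - G') * spectralNorm' G⁻¹ ≤ ε := by
    refine mul_le_mul_of_nonneg_right (hF.trans ?_) hsn
    have hsqrt : Real.sqrt (2 * r) ≤ Real.sqrt (2 * r * n) :=
      Real.sqrt_le_sqrt (le_mul_of_one_le_right (by positivity) hn1)
    gcongr
  have hform (x : EuclideanSpace ℝ (Fin n)) :
      |x.ofLp ⬝ᵥ G.mulVec x.ofLp - x.ofLp ⬝ᵥ G'.mulVec x.ofLp| ≤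
        ε * (x.ofLp ⬝ᵥ G.mulVec x.ofLp) := by
    have hGx : 0 ≤ x.ofLp ⬝ᵥ G.mulVec x.ofLp := by
      simpa using hG.posSemidef.dotProduct_mulVec_nonneg x.ofLp
    rw [← dotProduct_sub, ← Matrix.sub_mulVec]
    calc _ ≤ frobNorm (G - G') * ‖x‖ ^ 2 := abs_dotProduct_mulVec_le_frobNorm _ _
      _ ≤ frobNorm (G - G') * (spectralNorm' G⁻¹ * (x.ofLp ⬝ᵥ G.mulVec x.ofLp)) :=
          mul_le_mul_of_nonneg_left (hG.norm_sq_le_spectralNorm'_inv_mul x) (Real.sqrt_nonneg _)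
      _ ≤ _ := by
          rw [← mul_assoc]
          exact mul_le_mul_of_nonneg_right hF' hGx
  have hc : 0 < 1 - ε := sub_pos.mpr hsmall
  have h1 := hG.isHermitian.mul_eigenvalues_le_eigenvalues hG'.isHermitian hc.le fun x => by
    linarith [(abs_le.mp (hform x)).2]
  have h2 := hG'.isHermitian.mul_eigenvalues_le_eigenvalues hG.isHermitian hc.le fun x => by
    have hGx : 0 ≤ x.ofLp ⬝ᵥ G.mulVec x.ofLp := by
      simpa using hG.posSemidef.dotProduct_mulVec_nonneg x.ofLp
    nlinarith [(abs_le.mp (hform x)).1, mul_nonneg (sq_nonneg ε) hGx]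
  have hpos : 0 < ∑ i, hG.isHermitian.eigenvalues i ^ α :=
    Finset.sum_pos (fun i _ => Real.rpow_pos_of_pos (hG.eigenvalues_pos i) α) ⟨⟨0, hn⟩, by simp⟩
  have hlog := abs_logb_two_sub_logb_two_le hpos hc
    (rpow_mul_sum_rpow_le hc.le hα.le (fun i => (hG.eigenvalues_pos i).le) h1)
    (rpow_mul_sum_rpow_le hc.le hα.le hG'.eigenvalues_nonneg h2)
  rw [← mul_sub, abs_mul, div_eq_mul_one_div α, mul_comm α, mul_assoc,
    abs_mul (1 / (1 - α)) (α * _)]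
  exact mul_le_mul_of_nonneg_left hlog (abs_nonneg _)
end
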